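/- arXiv:1105.3505 — 2 statements merged into one kernel-verified Lean document; each statement's English description precedes it below -/
import Mathlib

section
/- There exists a constant C > 0 such that for every m = (m₁, m₂) ∈ ℤ² with m ≠ (0,0), |φ(m) − [ −(1/(2π))(log|m| + γ + (log 8)/2) + (1/(24π)) (m₁⁴ − 6m₁²m₂² + m₂⁴)/|m|⁶ + (1/(480π)) (43m₁⁸ − 772m₁⁶m₂² + 1570m₁⁴m₂⁴ − 772m₁²m₂⁶ + 43m₂⁸)/|m|¹² ]| ≤ C / |m|⁶, where |m| = √(m₁² + m₂²) and γ is the Euler–Mascheroni constant. -/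
open Real MeasureTheory Filter

/-- The integrand of the lattice fundamental solution. -/
noncomputable def latticeKernel (m : ℤ × ℤ) (t : ℝ × ℝ) : ℝ :=
  (Real.cos (t.1 * (m.1 : ℝ) + t.2 * (m.2 : ℝ)) - 1) /
    (4 * Real.sin (t.1 / 2) ^ 2 + 4 * Real.sin (t.2 / 2) ^ 2)

/-- The lattice fundamental solution `φ`. -/
noncomputable def phi (m : ℤ × ℤ) : ℝ :=
  (1 / (2 * Real.pi) ^ 2) *
    ∫ t in Set.Icc (-Real.pi) Real.pi ×ˢ Set.Icc (-Real.pi) Real.pi, latticeKernel m t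
/-- The Euclidean norm `|m| = √(m₁² + m₂²)` of a lattice point. -/
noncomputable def latNorm (m : ℤ × ℤ) : ℝ :=
  Real.sqrt ((m.1 : ℝ) ^ 2 + (m.2 : ℝ) ^ 2)

/-- The decay rate `s(k)` determined by `cosh (s k) = 2 - cos k`. -/
noncomputable def decayRate (k : ℝ) : ℝ := 2 * Real.arsinh (Real.sin (k / 2))

/-- The value `sinh (s k)` on `[0, π]`, in algebraic form. -/
noncomputable def decaySinh (k : ℝ) : ℝ := Real.sqrt ((1 - Real.cos k) * (3 - Real.cos k))

lemma cos_eq_one_sub_two_sin_half_sq (k : ℝ) : Real.cos k = 1 - 2 * Real.sin (k / 2) ^ 2 := by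
  have h := Real.cos_two_mul (k / 2)
  have h' := Real.sin_sq_add_cos_sq (k / 2)
  rw [mul_div_cancel₀ k two_ne_zero] at h
  linarith

lemma cosh_decayRate (k : ℝ) : Real.cosh (decayRate k) = 2 - Real.cos k := by
  rw [decayRate, Real.cosh_two_mul, Real.cosh_sq, Real.sinh_arsinh,
    cos_eq_one_sub_two_sin_half_sq k]
  ring

lemma decaySinh_sq (k : ℝ) : decaySinh k ^ 2 = (1 - Real.cos k) * (3 - Real.cos k) :=
  Real.sq_sqrt (mul_nonneg (by linarith [Real.cos_le_one k]) (by linarith [Real.cos_le_one k]))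

lemma decayRate_nonneg {k : ℝ} (h0 : 0 ≤ k) (h1 : k ≤ Real.pi) : 0 ≤ decayRate k := by
  have : 0 ≤ Real.arsinh (Real.sin (k / 2)) :=
    Real.arsinh_nonneg_iff.2 (Real.sin_nonneg_of_nonneg_of_le_pi (by linarith) (by linarith))
  unfold decayRate
  linarith

lemma sinh_decayRate {k : ℝ} (h0 : 0 ≤ k) (h1 : k ≤ Real.pi) :
    Real.sinh (decayRate k) = decaySinh k := by
  have hs : 0 ≤ Real.sinh (decayRate k) := Real.sinh_nonneg_iff.2 (decayRate_nonneg h0 h1)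
  rw [← Real.sqrt_sq hs, Real.sinh_sq, cosh_decayRate, decaySinh]
  congr 1
  ring

lemma div_le_decayRate {k : ℝ} (h0 : 0 ≤ k) (h1 : k ≤ Real.pi) : k / 4 ≤ decayRate k := by
  have hx : k / 4 ≤ Real.sin (k / 2) := by
    have h := Real.mul_le_sin (x := k / 2) (by linarith) (by linarith)
    refine le_trans ?_ h
    rw [div_mul_div_comm, div_le_div_iff₀ (by norm_num) (by positivity)]
    nlinarith [Real.pi_le_four]
  set x := Real.sin (k / 2) with hxd
  have hx0 : 0 ≤ x := by linarith
  have hx1 : x ≤ 1 := Real.sin_le_one _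
  have hl : x / 2 ≤ Real.arsinh x := by
    rw [Real.arsinh]
    have h1 : 1 + x ≤ x + Real.sqrt (1 + x ^ 2) := by
      have : (1 : ℝ) ≤ Real.sqrt (1 + x ^ 2) := Real.one_le_sqrt.2 (by nlinarith)
      linarith
    have h2 := Real.log_le_log (by linarith) h1
    have h3 := Real.one_sub_inv_le_log_of_pos (x := 1 + x) (by linarith)
    have h4 : x / 2 ≤ 1 - (1 + x)⁻¹ := by
      rw [show 1 - (1 + x)⁻¹ = x / (1 + x) by field_simp; ring]
      gcongr
      linarith
    linarith
  unfold decayRate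
  linarith

lemma mul_le_decaySinh {k : ℝ} (h0 : 0 ≤ k) (h1 : k ≤ Real.pi) : k / 2 ≤ decaySinh k := by
  refine Real.le_sqrt_of_sq_le ?_
  have h := Real.cos_le_one_sub_mul_cos_sq (x := k) (by rwa [abs_of_nonneg h0])
  have hc := Real.cos_le_one k
  have h2 : k ^ 2 / 8 ≤ 2 / Real.pi ^ 2 * k ^ 2 := by
    rw [div_mul_eq_mul_div, div_le_div_iff₀ (by norm_num) (by positivity)]
    have : Real.pi ^ 2 ≤ 16 := by nlinarith [Real.pi_le_four, Real.pi_pos]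
    nlinarith [sq_nonneg k]
  nlinarith [sq_nonneg k]

lemma abs_cos_sub_taylor_le {k : ℝ} (h0 : 0 ≤ k) (h1 : k ≤ 1) :
    |Real.cos k - (1 - k ^ 2 / 2 + k ^ 4 / 24 - k ^ 6 / 720)| ≤ k ^ 8 := by
  have hn : ‖(k : ℂ) * Complex.I‖ = k := by simp [abs_of_nonneg h0]
  have h := Complex.exp_bound (x := (k : ℂ) * Complex.I) (by rw [hn]; exact h1) (n := 8) (by norm_num)
  have h' := (Complex.abs_re_le_norm _).trans h
  rw [hn] at h'
  have e : (Complex.exp ((k : ℂ) * Complex.I) - ∑ m ∈ Finset.range 8,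
      ((k : ℂ) * Complex.I) ^ m / (m.factorial : ℂ)).re
      = Real.cos k - (1 - k ^ 2 / 2 + k ^ 4 / 24 - k ^ 6 / 720) := by
    have : ∑ m ∈ Finset.range 8, ((k : ℂ) * Complex.I) ^ m / (m.factorial : ℂ)
      = ((1 - k ^ 2 / 2 + k ^ 4 / 24 - k ^ 6 / 720 : ℝ) : ℂ)
        + ((k - k ^ 3 / 6 + k ^ 5 / 120 - k ^ 7 / 5040 : ℝ) : ℂ) * Complex.I := by
      simp only [Finset.sum_range_succ, Finset.sum_range_zero, mul_pow, Nat.factorial]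
      have e3 : Complex.I ^ 3 = -Complex.I := Complex.I_pow_three
      have e4 : Complex.I ^ 4 = 1 := Complex.I_pow_four
      have e5 : Complex.I ^ 5 = Complex.I := by rw [pow_succ, e4, one_mul]
      have e6 : Complex.I ^ 6 = -1 := by rw [pow_succ, e5, Complex.I_mul_I]
      have e7 : Complex.I ^ 7 = -Complex.I := by rw [pow_succ, e6]; ring
      rw [e3, e4, e5, e6, e7, Complex.I_sq]
      push_cast
      ring
    rw [this, Complex.exp_mul_I, ← Complex.ofReal_cos, ← Complex.ofReal_sin]
    simp only [Complex.sub_re, Complex.add_re, Complex.re_ofReal_mul, Complex.I_re,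
      Complex.ofReal_re, mul_zero, add_zero]
  rw [e] at h'
  refine h'.trans ?_
  have : (0:ℝ) ≤ k ^ 8 := by positivity
  norm_num [Nat.factorial]
  nlinarith

/-- On `[0, 1]` the cosine is its Taylor polynomial plus `k ^ 8` times a bounded factor. -/
lemma exists_cos_eq_taylor {k : ℝ} (h0 : 0 < k) (h1 : k ≤ 1) :
    ∃ r ∈ Set.Icc (-1 : ℝ) 1,
      Real.cos k = 1 - k ^ 2 / 2 + k ^ 4 / 24 - k ^ 6 / 720 + k ^ 8 * r := by
  have h := abs_cos_sub_taylor_le h0.le h1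
  have hk : 0 < k ^ 8 := by positivity
  refine ⟨(Real.cos k - (1 - k ^ 2 / 2 + k ^ 4 / 24 - k ^ 6 / 720)) / k ^ 8, ?_, ?_⟩
  · rw [Set.mem_Icc, ← abs_le, abs_div, abs_of_pos hk, div_le_one hk]
    exact h
  · field_simp
    ring

/-- A jointly continuous function is bounded on the compact set `[0, b] × [-1, 1]`. -/
lemma exists_bound_of_continuous (b : ℝ) {Q : ℝ → ℝ → ℝ} (hQ : Continuous (fun x : ℝ × ℝ => Q x.1 x.2)) :
    ∃ C : ℝ, 0 < C ∧ ∀ k ∈ Set.Icc (0 : ℝ) b, ∀ r ∈ Set.Icc (-1 : ℝ) 1, |Q k r| ≤ C := by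
  obtain ⟨C, hC⟩ := ((isCompact_Icc (a := (0 : ℝ)) (b := b)).prod
    (isCompact_Icc (a := (-1 : ℝ)) (b := 1))).exists_bound_of_continuousOn hQ.continuousOn
  exact ⟨max C 1, by positivity, fun k hk r hr => (hC (k, r) ⟨hk, hr⟩).trans (le_max_left _ _)⟩

lemma exists_inv_decaySinh_bound : ∃ C : ℝ, 0 < C ∧ ∀ k : ℝ, 0 < k → k ≤ Real.pi →
    |(decaySinh k)⁻¹ - (1 - k ^ 2 / 12 + 43 * k ^ 4 / 1440) / k| ≤ C * k ^ 5 := by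
  obtain ⟨C₁, hC₁, h₁⟩ := exists_bound_of_continuous 1 (Q := fun k r =>
    (17/1080) + (-2189/691200)*k^2 + (2371/4147200)*k^4 + (-5437/93312000)*k^6
      + (20849/5971968000)*k^8 + (-2021/17915904000)*k^10 + (1849/1074954240000)*k^12
      - r * (1 - k ^ 2 / 12 + 43 * k ^ 4 / 1440) ^ 2
        * (4 - 2 * (1 - k ^ 2 / 2 + k ^ 4 / 24 - k ^ 6 / 720))
      + k ^ 8 * r ^ 2 * (1 - k ^ 2 / 12 + 43 * k ^ 4 / 1440) ^ 2) (by fun_prop)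
  obtain ⟨C₂, hC₂, h₂⟩ := exists_bound_of_continuous Real.pi (Q := fun k _ =>
    (1 - k ^ 2 / 12 + 43 * k ^ 4 / 1440)) (by fun_prop)
  refine ⟨2 * C₁ + (2 + C₂), by positivity, fun k h0 hkpi => ?_⟩
  have hD : k / 2 ≤ decaySinh k := mul_le_decaySinh h0.le hkpi
  have hDpos : 0 < decaySinh k := by linarith
  set D := decaySinh k with hDdef
  set p := 1 - k ^ 2 / 12 + 43 * k ^ 4 / 1440 with hp
  rcases le_total k 1 with hk1 | hk1
  · obtain ⟨r, hr, hcos⟩ := exists_cos_eq_taylor h0 hk1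
    have hQ := h₁ k ⟨h0.le, hk1⟩ r hr
    have hDsq := decaySinh_sq k
    rw [← hDdef, hcos] at hDsq
    have hpp : 0 ≤ p := by rw [hp]; nlinarith [pow_pos h0 4]
    have hkey : |p * D - k| * (p * D + k) ≤ C₁ * k ^ 8 := by
      rw [← abs_of_nonneg (show 0 ≤ p * D + k by positivity), ← abs_mul]
      have : (p * D - k) * (p * D + k) = k ^ 8 * ((17/1080) + (-2189/691200)*k^2 + (2371/4147200)*k^4 + (-5437/93312000)*k^6
      + (20849/5971968000)*k^8 + (-2021/17915904000)*k^10 + (1849/1074954240000)*k^12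
      - r * (1 - k ^ 2 / 12 + 43 * k ^ 4 / 1440) ^ 2
        * (4 - 2 * (1 - k ^ 2 / 2 + k ^ 4 / 24 - k ^ 6 / 720))
      + k ^ 8 * r ^ 2 * (1 - k ^ 2 / 12 + 43 * k ^ 4 / 1440) ^ 2) := by
        have : (p * D - k) * (p * D + k) = p ^ 2 * D ^ 2 - k ^ 2 := by ring
        rw [this, hDsq, hp]
        ring
      rw [this, abs_mul, abs_of_nonneg (by positivity : (0:ℝ) ≤ k ^ 8), mul_comm]
      gcongr
    have hkey2 : |p * D - k| ≤ C₁ * k ^ 7 := by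
      have : |p * D - k| * k ≤ C₁ * k ^ 7 * k := by
        calc |p * D - k| * k ≤ |p * D - k| * (p * D + k) := by
              gcongr
              have := mul_nonneg hpp hDpos.le
              linarith
          _ ≤ C₁ * k ^ 8 := hkey
          _ = C₁ * k ^ 7 * k := by ring
      exact le_of_mul_le_mul_right this h0
    have e : D⁻¹ - p / k = -(p * D - k) / (D * k) := by field_simp; ring
    rw [e, abs_div, abs_neg, abs_of_pos (mul_pos hDpos h0), div_le_iff₀ (mul_pos hDpos h0)]
    calc |p * D - k| ≤ C₁ * k ^ 7 := hkey2
      _ = (2 * C₁) * k ^ 5 * (k / 2 * k) := by ring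
      _ ≤ (2 * C₁ + (2 + C₂)) * k ^ 5 * (D * k) := by
        gcongr
        linarith
  · have hp2 : |p| ≤ C₂ := h₂ k ⟨h0.le, hkpi⟩ 0 (by norm_num)
    have hDi : |D⁻¹| ≤ 2 := by
      rw [abs_of_pos (inv_pos.2 hDpos)]
      exact inv_le_of_inv_le₀ (by norm_num) (by linarith)
    have hpk : |p / k| ≤ C₂ := by
      rw [abs_div, abs_of_pos h0]
      exact (div_le_self (abs_nonneg _) hk1).trans hp2
    have hk5 : 1 ≤ k ^ 5 := one_le_pow₀ hk1
    calc |D⁻¹ - p / k| ≤ |D⁻¹| + |p / k| := abs_sub _ _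
      _ ≤ 2 + C₂ := by linarith
      _ ≤ 2 * C₁ + (2 + C₂) := by linarith
      _ ≤ (2 * C₁ + (2 + C₂)) * k ^ 5 := le_mul_of_one_le_right (by positivity) hk5

lemma hasDerivAt_decayRate (k : ℝ) :
    HasDerivAt decayRate (Real.cos (k / 2) / Real.sqrt (1 + Real.sin (k / 2) ^ 2)) k := by
  have h : HasDerivAt (fun k : ℝ => Real.sin (k / 2)) (Real.cos (k / 2) * (1 / 2)) k :=
    ((hasDerivAt_id k).div_const 2).sin
  convert! (h.arsinh.const_mul 2) using 1
  simp only [smul_eq_mul]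
  ring

lemma exists_deriv_decayRate_bound : ∃ C : ℝ, 0 < C ∧ ∀ k : ℝ, 0 ≤ k → k ≤ Real.pi →
    |Real.cos (k / 2) / Real.sqrt (1 + Real.sin (k / 2) ^ 2) - (1 - k ^ 2 / 4 + 5 * k ^ 4 / 96)|
      ≤ C * k ^ 6 := by
  obtain ⟨C₁, hC₁, h₁⟩ := exists_bound_of_continuous 1 (Q := fun k r =>
    (-79/1440) + (39/2560)*k^2 + (-739/276480)*k^4 + (11/73728)*k^6 + (-5/1327104)*k^8
      + k ^ 2 * r * (1 + (1 - k ^ 2 / 4 + 5 * k ^ 4 / 96) ^ 2)) (by fun_prop)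
  obtain ⟨C₂, hC₂, h₂⟩ := exists_bound_of_continuous Real.pi (Q := fun k _ =>
    (1 - k ^ 2 / 4 + 5 * k ^ 4 / 96)) (by fun_prop)
  refine ⟨2 * C₁ + (1 + C₂), by positivity, fun k h0 hkpi => ?_⟩
  have hc0 : 0 ≤ Real.cos (k / 2) := Real.cos_nonneg_of_neg_pi_div_two_le_of_le
    (by linarith [Real.pi_pos]) (by linarith)
  have hw : 1 ≤ Real.sqrt (1 + Real.sin (k / 2) ^ 2) := Real.one_le_sqrt.2 (by nlinarith [sq_nonneg (Real.sin (k/2))])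
  set d := Real.cos (k / 2) / Real.sqrt (1 + Real.sin (k / 2) ^ 2) with hd
  have hd0 : 0 ≤ d := by positivity
  have hd1 : d ≤ 1 := (div_le_self hc0 hw).trans (Real.cos_le_one _)
  have hdsq : d ^ 2 * (3 - Real.cos k) = 1 + Real.cos k := by
    have := Real.sin_sq_add_cos_sq (k / 2)
    have hpos : 0 < 1 + Real.sin (k / 2) ^ 2 := by positivity
    rw [hd, div_pow, Real.sq_sqrt hpos.le, cos_eq_one_sub_two_sin_half_sq k]
    field_simp
    nlinarith
  set q := 1 - k ^ 2 / 4 + 5 * k ^ 4 / 96 with hq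
  rcases le_total k 1 with hk1 | hk1
  · rcases h0.eq_or_lt with rfl | h0
    · simp [hd, hq]
    obtain ⟨r, hr, hcos⟩ := exists_cos_eq_taylor h0 hk1
    have hQ := h₁ k ⟨h0.le, hk1⟩ r hr
    have hqq : 1 / 2 ≤ q := by rw [hq]; nlinarith [pow_pos h0 4]
    have h3 : 2 ≤ 3 - Real.cos k := by linarith [Real.cos_le_one k]
    have hkey : |d - q| * ((d + q) * (3 - Real.cos k)) ≤ C₁ * k ^ 6 := by
      rw [← abs_of_nonneg (show 0 ≤ (d + q) * (3 - Real.cos k) by positivity), ← abs_mul]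
      have : (d - q) * ((d + q) * (3 - Real.cos k)) = k ^ 6 * ((-79/1440) + (39/2560)*k^2 + (-739/276480)*k^4 + (11/73728)*k^6 + (-5/1327104)*k^8
      + k ^ 2 * r * (1 + (1 - k ^ 2 / 4 + 5 * k ^ 4 / 96) ^ 2)) := by
        have : (d - q) * ((d + q) * (3 - Real.cos k))
          = d ^ 2 * (3 - Real.cos k) - q ^ 2 * (3 - Real.cos k) := by ring
        rw [this, hdsq, hcos, hq]
        ring
      rw [this, abs_mul, abs_of_nonneg (by positivity : (0:ℝ) ≤ k ^ 6), mul_comm]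
      gcongr
    have h4 : 1 ≤ (d + q) * (3 - Real.cos k) := by nlinarith
    calc |d - q| ≤ |d - q| * ((d + q) * (3 - Real.cos k)) :=
          le_mul_of_one_le_right (abs_nonneg _) h4
      _ ≤ C₁ * k ^ 6 := hkey
      _ ≤ (2 * C₁ + (1 + C₂)) * k ^ 6 := by gcongr; linarith
  · have hq2 : |q| ≤ C₂ := h₂ k ⟨h0, hkpi⟩ 0 (by norm_num)
    have hk6 : 1 ≤ k ^ 6 := one_le_pow₀ hk1
    calc |d - q| ≤ |d| + |q| := abs_sub _ _
      _ ≤ 1 + C₂ := by rw [abs_of_nonneg hd0]; linarith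
      _ ≤ 2 * C₁ + (1 + C₂) := by linarith
      _ ≤ (2 * C₁ + (1 + C₂)) * k ^ 6 := le_mul_of_one_le_right (by positivity) hk6

lemma decayRate_zero : decayRate 0 = 0 := by simp [decayRate]

lemma decayRate_le {k : ℝ} (h0 : 0 ≤ k) : decayRate k ≤ k := by
  have h : Real.arsinh (Real.sin (k / 2)) ≤ k / 2 := by
    rw [← Real.sinh_le_sinh, Real.sinh_arsinh]
    exact (Real.sin_le (by linarith)).trans (Real.self_le_sinh_iff.2 (by linarith))
  unfold decayRate
  linarith

lemma exists_decayRate_bound : ∃ C : ℝ, 0 < C ∧ ∀ k : ℝ, 0 ≤ k → k ≤ Real.pi →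
    |decayRate k - (k - k ^ 3 / 12 + k ^ 5 / 96)| ≤ C * k ^ 7 := by
  obtain ⟨C, hC, h⟩ := exists_deriv_decayRate_bound
  refine ⟨C, hC, fun k h0 hkpi => ?_⟩
  have hder : ∀ t ∈ Set.Icc 0 k, HasDerivWithinAt
      (fun t => decayRate t - (t - t ^ 3 / 12 + t ^ 5 / 96))
      (Real.cos (t / 2) / Real.sqrt (1 + Real.sin (t / 2) ^ 2)
        - (1 - t ^ 2 / 4 + 5 * t ^ 4 / 96)) (Set.Icc 0 k) t := by
    intro t _
    refine HasDerivAt.hasDerivWithinAt ((hasDerivAt_decayRate t).sub ?_)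
    convert! (((hasDerivAt_id t).sub ((hasDerivAt_pow 3 t).div_const 12)).add
      ((hasDerivAt_pow 5 t).div_const 96)) using 1
    norm_num
    ring
  have := (convex_Icc 0 k).norm_image_sub_le_of_norm_hasDerivWithin_le (C := C * k ^ 6) hder
    (fun t ht => by
      rw [Real.norm_eq_abs]
      refine (h t ht.1 (ht.2.trans hkpi)).trans ?_
      have := pow_le_pow_left₀ ht.1 ht.2 6
      gcongr) (Set.left_mem_Icc.2 h0) (Set.right_mem_Icc.2 h0)
  simp only [decayRate_zero, Real.norm_eq_abs] at this
  norm_num [abs_of_nonneg h0] at this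
  calc _ ≤ C * k ^ 6 * k := by simpa using this
    _ = C * k ^ 7 := by ring

lemma abs_exp_sub_quadratic_le {x : ℝ} (hx : 0 ≤ x) :
    |Real.exp x - (1 + x + x ^ 2 / 2)| ≤ x ^ 3 * Real.exp x := by
  have h := Complex.norm_exp_sub_sum_le_norm_mul_exp (x : ℂ) 3
  have e : Complex.exp (x : ℂ) - ∑ m ∈ Finset.range 3, (x : ℂ) ^ m / (m.factorial : ℂ)
      = ((Real.exp x - (1 + x + x ^ 2 / 2) : ℝ) : ℂ) := by
    simp [Finset.sum_range_succ, Nat.factorial]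
  rw [e, Complex.norm_real, Complex.norm_real, Real.norm_eq_abs, Real.norm_eq_abs,
    abs_of_nonneg hx] at h
  exact h

lemma exists_decayRate_bounds : ∃ B : ℝ, 0 < B ∧ ∀ k : ℝ, 0 < k → k ≤ Real.pi →
    |(k - decayRate k) - (k ^ 3 / 12 - k ^ 5 / 96)| ≤ B * k ^ 7 ∧
    |(k - decayRate k) - k ^ 3 / 12| ≤ B * k ^ 5 ∧ k - decayRate k ≤ B * k ^ 3 := by
  obtain ⟨C, hC, h⟩ := exists_decayRate_bound
  refine ⟨256 * C + 10, by positivity, fun k h0 hkpi => ?_⟩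
  have hk4 : k ≤ 4 := hkpi.trans Real.pi_le_four
  have h1 : |(k - decayRate k) - (k ^ 3 / 12 - k ^ 5 / 96)| ≤ C * k ^ 7 := by
    rw [abs_sub_comm]
    convert! h k h0.le hkpi using 2
    ring
  have hk2 : k ^ 2 ≤ 16 := by nlinarith
  have hk5 : 0 < k ^ 5 := by positivity
  have hk3 : 0 < k ^ 3 := by positivity
  have hk7 : 0 < k ^ 7 := by positivity
  have e7 : k ^ 7 ≤ 16 * k ^ 5 := by
    calc k ^ 7 = k ^ 2 * k ^ 5 := by ring
      _ ≤ _ := by gcongr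
  have e5 : k ^ 5 ≤ 16 * k ^ 3 := by
    calc k ^ 5 = k ^ 2 * k ^ 3 := by ring
      _ ≤ _ := by gcongr
  have hC7 : C * k ^ 7 ≤ 16 * C * k ^ 5 := by nlinarith
  have hC5 : 16 * C * k ^ 5 ≤ 256 * C * k ^ 3 := by nlinarith
  have p5 : 0 < C * k ^ 5 := by positivity
  have p7 : 0 < C * k ^ 7 := by positivity
  obtain ⟨ha, hb⟩ := abs_le.1 h1
  refine ⟨?_, ?_, ?_⟩
  · refine h1.trans ?_
    nlinarith
  · rw [abs_le]
    constructor <;> nlinarith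
  · nlinarith

/-- The polynomial in `k` and `y` which multiplies `exp (-(y * k)) / k` in the
approximation of `exp (-(y * s k)) / sinh (s k)`. -/
noncomputable def approxPoly (y k : ℝ) : ℝ :=
  1 - k ^ 2 / 12 + y * k ^ 3 / 12 + 43 * k ^ 4 / 1440 - 5 * y * k ^ 5 / 288
    + y ^ 2 * k ^ 6 / 288

lemma exists_exp_decayRate_bound : ∃ C : ℝ, 0 < C ∧ ∀ k y : ℝ, 0 < k → k ≤ Real.pi → 0 ≤ y →
    |Real.exp (-(y * decayRate k)) - Real.exp (-(y * k)) *
        (1 + y * (k ^ 3 / 12 - k ^ 5 / 96) + y ^ 2 * k ^ 6 / 288)|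
      ≤ C * (y * k ^ 7 + y ^ 2 * k ^ 8 + y ^ 3 * k ^ 9) * Real.exp (-(y / 4 * k)) := by
  obtain ⟨B, hB, h⟩ := exists_decayRate_bounds
  refine ⟨B + B * (B + 1) + B ^ 3, by positivity, fun k y h0 hkpi hy => ?_⟩
  obtain ⟨h7, h5, h3⟩ := h k h0 hkpi
  have hd0 : 0 ≤ k - decayRate k := by linarith [decayRate_le h0.le]
  have hs : k / 4 ≤ decayRate k := div_le_decayRate h0.le hkpi
  set d := k - decayRate k with hd
  have hE : Real.exp (-(y * decayRate k)) = Real.exp (-(y * k)) * Real.exp (y * d) := by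
    rw [← Real.exp_add]
    congr 1
    rw [hd]
    ring
  have hE4 : Real.exp (-(y * decayRate k)) ≤ Real.exp (-(y / 4 * k)) := by
    apply Real.exp_le_exp.2
    nlinarith
  have he4 : Real.exp (-(y * k)) ≤ Real.exp (-(y / 4 * k)) := by
    apply Real.exp_le_exp.2
    nlinarith [mul_nonneg hy h0.le]
  set e := Real.exp (-(y * k)) with he
  set f := Real.exp (-(y / 4 * k)) with hf
  have hepos : 0 < e := Real.exp_pos _
  have hfpos : 0 < f := Real.exp_pos _
  have hx := abs_exp_sub_quadratic_le (mul_nonneg hy hd0)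
  have t1 : |e * (Real.exp (y * d) - (1 + y * d + (y * d) ^ 2 / 2))|
      ≤ B ^ 3 * (y ^ 3 * k ^ 9) * f := by
    rw [abs_mul, abs_of_pos hepos]
    calc e * |Real.exp (y * d) - (1 + y * d + (y * d) ^ 2 / 2)|
        ≤ e * ((y * d) ^ 3 * Real.exp (y * d)) := by gcongr
      _ = (y * d) ^ 3 * (e * Real.exp (y * d)) := by ring
      _ ≤ (y * (B * k ^ 3)) ^ 3 * f := by
        rw [hE] at hE4
        gcongr
      _ = B ^ 3 * (y ^ 3 * k ^ 9) * f := by ring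
  have t2 : |e * (y * (d - (k ^ 3 / 12 - k ^ 5 / 96)))| ≤ B * (y * k ^ 7) * f := by
    rw [abs_mul, abs_mul, abs_of_pos hepos, abs_of_nonneg hy]
    calc e * (y * |d - (k ^ 3 / 12 - k ^ 5 / 96)|) ≤ f * (y * (B * k ^ 7)) := by gcongr
      _ = _ := by ring
  have t3 : |e * (y ^ 2 / 2 * ((d - k ^ 3 / 12) * (d + k ^ 3 / 12)))|
      ≤ B * (B + 1) * (y ^ 2 * k ^ 8) * f := by
    have hk3 : 0 < k ^ 3 := by positivity
    rw [abs_mul, abs_mul, abs_mul, abs_of_pos hepos, abs_of_nonneg (by positivity : 0 ≤ y ^ 2 / 2),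
      abs_of_nonneg (by positivity : 0 ≤ d + k ^ 3 / 12)]
    calc e * (y ^ 2 / 2 * (|d - k ^ 3 / 12| * (d + k ^ 3 / 12)))
        ≤ f * (y ^ 2 * ((B * k ^ 5) * ((B + 1) * k ^ 3))) := by
          gcongr
          · linarith [sq_nonneg y]
          · linarith
      _ = _ := by ring
  rw [hE]
  have key : e * Real.exp (y * d) - e * (1 + y * (k ^ 3 / 12 - k ^ 5 / 96) + y ^ 2 * k ^ 6 / 288)
      = e * (Real.exp (y * d) - (1 + y * d + (y * d) ^ 2 / 2))
        + e * (y * (d - (k ^ 3 / 12 - k ^ 5 / 96)))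
        + e * (y ^ 2 / 2 * ((d - k ^ 3 / 12) * (d + k ^ 3 / 12))) := by ring
  rw [key]
  refine (abs_add_three _ _ _).trans ((add_le_add (add_le_add t1 t2) t3).trans ?_)
  have q1 : 0 ≤ y * k ^ 7 * f := by positivity
  have q2 : 0 ≤ y ^ 2 * k ^ 8 * f := by positivity
  have q3 : 0 ≤ y ^ 3 * k ^ 9 * f := by positivity
  have r1 : 0 ≤ B * (B + 1) + B ^ 3 := by positivity
  have r2 : 0 ≤ B + B ^ 3 := by positivity
  have r3 : 0 ≤ B + B * (B + 1) := by positivity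
  nlinarith [mul_nonneg r1 q1, mul_nonneg r2 q2, mul_nonneg r3 q3]

lemma exists_integrand_bound : ∃ C : ℝ, 0 < C ∧ ∀ k y : ℝ, 0 < k → k ≤ Real.pi → 0 ≤ y →
    |Real.exp (-(y * decayRate k)) / decaySinh k - Real.exp (-(y * k)) * approxPoly y k / k|
      ≤ C * (k ^ 5 + y * k ^ 6 + y ^ 2 * k ^ 7 + y ^ 3 * k ^ 8) * Real.exp (-(y / 4 * k)) := by
  obtain ⟨C₁, hC₁, h₁⟩ := exists_exp_decayRate_bound
  obtain ⟨C₂, hC₂, h₂⟩ := exists_inv_decaySinh_bound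
  refine ⟨C₂ + 10 * C₁ + 1, by positivity, fun k y h0 hkpi hy => ?_⟩
  have b1 := h₁ k y h0 hkpi hy
  have b2 := h₂ k h0 hkpi
  have hs : k / 4 ≤ decayRate k := div_le_decayRate h0.le hkpi
  have hE4 : Real.exp (-(y * decayRate k)) ≤ Real.exp (-(y / 4 * k)) := by
    apply Real.exp_le_exp.2
    nlinarith
  have he4 : Real.exp (-(y * k)) ≤ Real.exp (-(y / 4 * k)) := by
    apply Real.exp_le_exp.2
    nlinarith [mul_nonneg hy h0.le]
  have hk4 : k ≤ 4 := hkpi.trans Real.pi_le_four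
  have hk2 : k ^ 2 ≤ 16 := by nlinarith
  have hk2' : 0 < k ^ 2 := by positivity
  set E := Real.exp (-(y * decayRate k)) with hE
  set e := Real.exp (-(y * k)) with he
  set f := Real.exp (-(y / 4 * k)) with hf
  set p := 1 - k ^ 2 / 12 + 43 * k ^ 4 / 1440 with hp
  have hp10 : |p| ≤ 10 := by
    rw [hp, abs_le, show k ^ 4 = (k ^ 2) ^ 2 by ring]
    constructor <;> nlinarith
  have hEpos : 0 < E := Real.exp_pos _
  have hepos : 0 < e := Real.exp_pos _
  have hfpos : 0 < f := Real.exp_pos _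
  have key : E / decaySinh k - e * approxPoly y k / k
      = E * ((decaySinh k)⁻¹ - p / k)
        + (E - e * (1 + y * (k ^ 3 / 12 - k ^ 5 / 96) + y ^ 2 * k ^ 6 / 288)) * (p / k)
        + e * (y * k ^ 6 * (43 / 17280 + 1 / 1152 - 43 * k ^ 2 / 138240)
          + y ^ 2 * k ^ 7 * ((-1 / 12 + 43 * k ^ 2 / 1440) / 288)) := by
    rw [hp, approxPoly]
    field_simp
    ring
  have t1 : |E * ((decaySinh k)⁻¹ - p / k)| ≤ C₂ * k ^ 5 * f := by
    rw [abs_mul, abs_of_pos hEpos, mul_comm]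
    gcongr
  have t2 : |(E - e * (1 + y * (k ^ 3 / 12 - k ^ 5 / 96) + y ^ 2 * k ^ 6 / 288)) * (p / k)|
      ≤ 10 * C₁ * (y * k ^ 6 + y ^ 2 * k ^ 7 + y ^ 3 * k ^ 8) * f := by
    rw [abs_mul, abs_div, abs_of_pos h0]
    calc _ ≤ (C₁ * (y * k ^ 7 + y ^ 2 * k ^ 8 + y ^ 3 * k ^ 9) * f) * (10 / k) := by gcongr
      _ = _ := by field_simp
  have t3 : |e * (y * k ^ 6 * (43 / 17280 + 1 / 1152 - 43 * k ^ 2 / 138240)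
          + y ^ 2 * k ^ 7 * ((-1 / 12 + 43 * k ^ 2 / 1440) / 288))|
      ≤ (y * k ^ 6 + y ^ 2 * k ^ 7) * f := by
    rw [abs_mul, abs_of_pos hepos, mul_comm]
    have a1 : |(43 / 17280 + 1 / 1152 - 43 * k ^ 2 / 138240 : ℝ)| ≤ 1 := by
      rw [abs_le]
      constructor <;> linarith
    have a2 : |((-1 / 12 + 43 * k ^ 2 / 1440) / 288 : ℝ)| ≤ 1 := by
      rw [abs_le]
      constructor <;> linarith
    gcongr
    refine (abs_add_le _ _).trans ?_
    rw [abs_mul (y * k ^ 6), abs_mul (y ^ 2 * k ^ 7), abs_of_nonneg (by positivity : 0 ≤ y * k ^ 6),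
      abs_of_nonneg (by positivity : 0 ≤ y ^ 2 * k ^ 7)]
    exact add_le_add (mul_le_of_le_one_right (by positivity) a1)
      (mul_le_of_le_one_right (by positivity) a2)
  rw [key]
  refine (abs_add_three _ _ _).trans ((add_le_add (add_le_add t1 t2) t3).trans ?_)
  have q0 : 0 ≤ k ^ 5 * f := by positivity
  have q1 : 0 ≤ y * k ^ 6 * f := by positivity
  have q2 : 0 ≤ y ^ 2 * k ^ 7 * f := by positivity
  have q3 : 0 ≤ y ^ 3 * k ^ 8 * f := by positivity
  nlinarith [mul_nonneg hC₂.le q1, mul_nonneg hC₂.le q2, mul_nonneg hC₂.le q3,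
    mul_nonneg hC₁.le q0]

lemma integrableOn_pow_mul_exp (j : ℕ) {y : ℝ} (hy : 0 < y) :
    IntegrableOn (fun k : ℝ => k ^ j * Real.exp (-(y * k))) (Set.Ioi 0) := by
  have h := integrableOn_rpow_mul_exp_neg_mul_rpow (p := 1) (s := j) (b := y)
    (by linarith [(Nat.cast_nonneg j : (0 : ℝ) ≤ j)]) one_pos hy
  refine h.congr_fun (fun k _ => ?_) measurableSet_Ioi
  simp

lemma integrableOn_pow_mul_cexp (j : ℕ) {z : ℂ} (hz : 0 < z.re) :
    IntegrableOn (fun k : ℝ => (k : ℂ) ^ j * Complex.exp (-(z * k))) (Set.Ioi 0) := by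
  refine (integrableOn_pow_mul_exp j hz).mono'
    (Continuous.aestronglyMeasurable (by fun_prop)) ?_
  filter_upwards [ae_restrict_mem measurableSet_Ioi] with k hk
  rw [norm_mul, norm_pow, Complex.norm_real, Real.norm_eq_abs, abs_of_pos hk, Complex.norm_exp]
  simp

lemma integral_pow_mul_cexp (j : ℕ) {z : ℂ} (hz : 0 < z.re) :
    ∫ k in Set.Ioi (0 : ℝ), (k : ℂ) ^ j * Complex.exp (-(z * k)) = j.factorial / z ^ (j + 1) := by
  have hz0 : z ≠ 0 := by
    rintro rfl
    simp at hz
  have htop : ∀ j : ℕ, Tendsto (fun k : ℝ => -((k : ℂ) ^ j * Complex.exp (-(z * k)) / z)) atTop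
      (nhds 0) := by
    intro j
    have h1 : Tendsto (fun k : ℝ => k ^ j * Real.exp (-z.re * k)) atTop (nhds 0) := by
      simpa using tendsto_rpow_mul_exp_neg_mul_atTop_nhds_zero j z.re hz
    have h2 : Tendsto (fun k : ℝ => (k : ℂ) ^ j * Complex.exp (-(z * k))) atTop (nhds 0) := by
      rw [tendsto_zero_iff_norm_tendsto_zero]
      refine h1.congr' ?_
      filter_upwards [eventually_gt_atTop 0] with k hk
      rw [norm_mul, norm_pow, Complex.norm_real, Real.norm_eq_abs, abs_of_pos hk,
        Complex.norm_exp]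
      simp
    simpa using (h2.div_const z).neg
  have hder : ∀ (j : ℕ) (k : ℝ), HasDerivAt (fun k : ℝ => -((k : ℂ) ^ j * Complex.exp (-(z * k)) / z))
      ((k : ℂ) ^ j * Complex.exp (-(z * k))
        - j / z * ((k : ℂ) ^ (j - 1) * Complex.exp (-(z * k)))) k := by
    intro j k
    have h1 : HasDerivAt (fun w : ℂ => -(w ^ j * Complex.exp (-(z * w)) / z))
      ((k : ℂ) ^ j * Complex.exp (-(z * k))
        - j / z * ((k : ℂ) ^ (j - 1) * Complex.exp (-(z * k)))) (k : ℂ) := by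
      have he : HasDerivAt (fun w : ℂ => Complex.exp (-(z * w))) (Complex.exp (-(z * k)) * (-(z * 1)))
          (k : ℂ) := (((hasDerivAt_id (k : ℂ)).const_mul z).neg).cexp
      convert! (((hasDerivAt_pow j (k : ℂ)).mul he).div_const z).neg using 1
      field_simp
      ring
    exact h1.comp_ofReal
  induction j with
  | zero =>
    have h := integral_Ioi_of_hasDerivAt_of_tendsto (a := (0 : ℝ)) (f' := fun k : ℝ =>
        (k : ℂ) ^ 0 * Complex.exp (-(z * k)))
      (hder 0 0).continuousAt.continuousWithinAt
      (fun k _ => by simpa using hder 0 k) (integrableOn_pow_mul_cexp 0 hz) (htop 0)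
    rw [h]
    simp
  | succ j ih =>
    have h := integral_Ioi_of_hasDerivAt_of_tendsto (a := (0 : ℝ))
      (hder (j + 1) 0).continuousAt.continuousWithinAt
      (fun k _ => hder (j + 1) k)
      ((integrableOn_pow_mul_cexp (j + 1) hz).sub
        ((integrableOn_pow_mul_cexp (j + 1 - 1) hz).const_mul _)) (htop (j + 1))
    rw [integral_sub (integrableOn_pow_mul_cexp (j + 1) hz)
        ((integrableOn_pow_mul_cexp (j + 1 - 1) hz).const_mul _), integral_const_mul,
        Nat.add_sub_cancel, ih] at h
    rw [sub_eq_iff_eq_add] at h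
    rw [h]
    push_cast [Nat.factorial_succ]
    simp
    field_simp
    ring

lemma integral_pow_mul_exp (j : ℕ) {y : ℝ} (hy : 0 < y) :
    ∫ k in Set.Ioi (0 : ℝ), k ^ j * Real.exp (-(y * k)) = j.factorial / y ^ (j + 1) := by
  have h := integral_pow_mul_cexp j (z := (y : ℂ)) (by simpa using hy)
  have e : ∀ k : ℝ, (k : ℂ) ^ j * Complex.exp (-((y : ℂ) * k))
      = ((k ^ j * Real.exp (-(y * k)) : ℝ) : ℂ) := by
    intro k
    push_cast
    rfl
  simp_rw [e] at h
  rw [integral_complex_ofReal] at h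
  exact_mod_cast h

lemma pow_mul_cexp_re (j : ℕ) (x y k : ℝ) :
    ((k : ℂ) ^ j * Complex.exp (-((y - x * Complex.I) * k))).re
      = k ^ j * (Real.exp (-(y * k)) * Real.cos (x * k)) := by
  rw [← Complex.ofReal_pow, Complex.re_ofReal_mul, Complex.exp_re]
  simp

lemma pow_mul_cexp_im (j : ℕ) (x y k : ℝ) :
    ((k : ℂ) ^ j * Complex.exp (-((y - x * Complex.I) * k))).im
      = k ^ j * (Real.exp (-(y * k)) * Real.sin (x * k)) := by
  rw [← Complex.ofReal_pow, Complex.im_ofReal_mul, Complex.exp_im]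
  simp

lemma integrableOn_pow_mul_exp_mul_cos (j : ℕ) (x : ℝ) {y : ℝ} (hy : 0 < y) :
    IntegrableOn (fun k : ℝ => k ^ j * (Real.exp (-(y * k)) * Real.cos (x * k))) (Set.Ioi 0) := by
  have h := (integrableOn_pow_mul_cexp j (z := y - x * Complex.I) (by simpa using hy)).re
  refine h.congr (Eventually.of_forall fun k => ?_)
  exact pow_mul_cexp_re j x y k

lemma integral_pow_mul_exp_mul_cos (j : ℕ) (x : ℝ) {y : ℝ} (hy : 0 < y) :
    ∫ k in Set.Ioi (0 : ℝ), k ^ j * (Real.exp (-(y * k)) * Real.cos (x * k))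
      = j.factorial * ((y + x * Complex.I) ^ (j + 1) : ℂ).re / (x ^ 2 + y ^ 2) ^ (j + 1) := by
  have hz : 0 < (y - x * Complex.I).re := by simpa using hy
  have h := integral_re (integrableOn_pow_mul_cexp j hz)
  simp only [RCLike.re_to_complex, pow_mul_cexp_re] at h
  rw [h, integral_pow_mul_cexp j hz]
  have hz0 : (y - x * Complex.I : ℂ) ≠ 0 := by
    intro h0
    rw [h0] at hz
    simp at hz
  have hN : ((x ^ 2 + y ^ 2 : ℝ) : ℂ) = (y - x * Complex.I) * (y + x * Complex.I) := by
    push_cast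
    ring_nf
    rw [Complex.I_sq]
    ring
  have hpos : (0 : ℝ) < x ^ 2 + y ^ 2 := by positivity
  have hpos' : ((x ^ 2 + y ^ 2 : ℝ) : ℂ) ≠ 0 := by exact_mod_cast hpos.ne'
  have hz1 : (y + x * Complex.I : ℂ) ≠ 0 := by
    intro h0
    rw [h0, mul_zero] at hN
    exact hpos' hN
  have e : (j.factorial : ℂ) / (y - x * Complex.I) ^ (j + 1)
      = ((j.factorial / (x ^ 2 + y ^ 2) ^ (j + 1) : ℝ) : ℂ) * (y + x * Complex.I) ^ (j + 1) := by
    have : ((j.factorial / (x ^ 2 + y ^ 2) ^ (j + 1) : ℝ) : ℂ)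
        = (j.factorial : ℂ) / ((x ^ 2 + y ^ 2 : ℝ) : ℂ) ^ (j + 1) := by push_cast; rfl
    rw [this, hN, mul_pow]
    field_simp
  rw [e, Complex.re_ofReal_mul]
  ring

lemma integral_exp_mul_sin (x : ℝ) {y : ℝ} (hy : 0 < y) :
    ∫ k in Set.Ioi (0 : ℝ), Real.exp (-(y * k)) * Real.sin (x * k) = x / (x ^ 2 + y ^ 2) := by
  have hz : 0 < (y - x * Complex.I).re := by simpa using hy
  have h := integral_im (integrableOn_pow_mul_cexp 0 hz)
  have h2 := integral_pow_mul_cexp 0 hz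
  simp only [RCLike.im_to_complex, pow_mul_cexp_im] at h
  simp only [pow_zero, one_mul] at h h2
  rw [h, h2]
  simp [Complex.inv_im, Complex.normSq_apply]
  ring_nf

/-- The tail of an exponential moment is dominated by any higher full moment. -/
lemma abs_setIntegral_Ioi_pi_le (j : ℕ) {y A : ℝ} (hy : 0 < y) {g : ℝ → ℝ}
    (hg : ∀ k, 1 ≤ k → |g k| ≤ A * (k ^ j * Real.exp (-(y * k)))) :
    |∫ k in Set.Ioi Real.pi, g k| ≤ A * (j.factorial / y ^ (j + 1)) := by
  have hA : 0 ≤ A := by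
    have h := (abs_nonneg _).trans (hg 1 le_rfl)
    exact nonneg_of_mul_nonneg_left h (by positivity)
  have hint := (integrableOn_pow_mul_exp j hy).const_mul A
  have hsub : Set.Ioi Real.pi ⊆ Set.Ioi 0 := Set.Ioi_subset_Ioi Real.pi_pos.le
  calc |∫ k in Set.Ioi Real.pi, g k|
      ≤ ∫ k in Set.Ioi Real.pi, A * (k ^ j * Real.exp (-(y * k))) := by
        rw [← Real.norm_eq_abs]
        refine norm_integral_le_of_norm_le (IntegrableOn.mono_set hint hsub) ?_
        filter_upwards [ae_restrict_mem measurableSet_Ioi] with k hk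
        exact hg k (by linarith [Real.pi_gt_three, Set.mem_Ioi.1 hk])
    _ ≤ ∫ k in Set.Ioi (0 : ℝ), A * (k ^ j * Real.exp (-(y * k))) := by
        refine setIntegral_mono_set hint ?_ hsub.eventuallyLE
        filter_upwards [ae_restrict_mem measurableSet_Ioi] with k hk
        have : (0 : ℝ) < k := hk
        positivity
    _ = _ := by rw [integral_const_mul, integral_pow_mul_exp j hy]

lemma integral_log_mul_exp_neg :
    ∫ u in Set.Ioi (0 : ℝ), Real.log u * Real.exp (-u) = -Real.eulerMascheroniConstant := by
  have h1 := Complex.hasDerivAt_GammaIntegral (s := 1) (by simp)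
  have h2 := Complex.hasDerivAt_Gamma_one
  have h3 : Complex.GammaIntegral =ᶠ[nhds 1] Complex.Gamma := by
    have : {s : ℂ | 0 < s.re} ∈ nhds (1 : ℂ) :=
      (isOpen_lt continuous_const Complex.continuous_re).mem_nhds (by simp)
    filter_upwards [this] with s hs
    exact (Complex.Gamma_eq_integral hs).symm
  have h4 := (h2.congr_of_eventuallyEq h3).unique h1
  have e : ∫ t in Set.Ioi (0 : ℝ), (t : ℂ) ^ ((1 : ℂ) - 1) * (Real.log t * Real.exp (-t) : ℂ)
      = ((∫ u in Set.Ioi (0 : ℝ), Real.log u * Real.exp (-u) : ℝ) : ℂ) := by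
    rw [← integral_complex_ofReal]
    refine setIntegral_congr_fun measurableSet_Ioi fun t _ => ?_
    simp
  rw [e] at h4
  exact_mod_cast h4.symm

lemma integrableOn_log_mul_exp_neg :
    IntegrableOn (fun u : ℝ => Real.log u * Real.exp (-u)) (Set.Ioi 0) := by
  refine Integrable.of_integral_ne_zero ?_
  rw [integral_log_mul_exp_neg]
  linarith [Real.one_half_lt_eulerMascheroniConstant]

lemma intervalIntegrable_of_abs_le {f : ℝ → ℝ} {b C : ℝ} (hb : 0 ≤ b) (hf : Measurable f)
    (h : ∀ k, 0 < k → k ≤ b → |f k| ≤ C) : IntervalIntegrable f volume 0 b := by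
  rw [intervalIntegrable_iff_integrableOn_Ioc_of_le hb]
  refine Measure.integrableOn_of_bounded (M := C) (by simp) hf.aestronglyMeasurable ?_
  filter_upwards [ae_restrict_mem measurableSet_Ioc] with k hk
  exact h k hk.1 hk.2

lemma abs_exp_neg_sub_one_le {u : ℝ} (hu : 0 ≤ u) : |Real.exp (-u) - 1| ≤ u := by
  rw [abs_le]
  constructor
  · linarith [Real.add_one_le_exp (-u)]
  · linarith [Real.exp_le_one_iff.2 (neg_nonpos.2 hu)]

lemma intervalIntegrable_exp_neg_mul_sub_one_div {y b : ℝ} (hy : 0 ≤ y) (hb : 0 ≤ b) :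
    IntervalIntegrable (fun k : ℝ => (Real.exp (-(y * k)) - 1) / k) volume 0 b := by
  refine intervalIntegrable_of_abs_le (C := y) hb (by fun_prop) fun k hk _ => ?_
  rw [abs_div, abs_of_pos hk, div_le_iff₀ hk]
  exact abs_exp_neg_sub_one_le (by positivity)

lemma integral_exp_neg_sub_one_div {b : ℝ} (hb : 0 < b) :
    ∫ u in (0 : ℝ)..b, (Real.exp (-u) - 1) / u
      = Real.log b * (Real.exp (-b) - 1) + ∫ u in (0 : ℝ)..b, Real.log u * Real.exp (-u) := by
  have hi1 : IntervalIntegrable (fun u : ℝ => (Real.exp (-u) - 1) / u) volume 0 b := by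
    simpa using intervalIntegrable_exp_neg_mul_sub_one_div zero_le_one hb.le
  have hi2 : IntervalIntegrable (fun u : ℝ => Real.log u * Real.exp (-u)) volume 0 b := by
    rw [intervalIntegrable_iff_integrableOn_Ioc_of_le hb.le]
    exact integrableOn_log_mul_exp_neg.mono_set Set.Ioc_subset_Ioi_self
  have h := intervalIntegral.integral_eq_sub_of_hasDerivAt_of_tendsto hb
    (f := fun u => Real.log u * (Real.exp (-u) - 1)) (fa := 0)
    (fb := Real.log b * (Real.exp (-b) - 1))
    (f' := fun u => (Real.exp (-u) - 1) / u - Real.log u * Real.exp (-u))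
    (fun u hu => by
      have he : HasDerivAt (fun u : ℝ => Real.exp (-u) - 1) (Real.exp (-u) * (-1)) u :=
        ((hasDerivAt_id u).neg.exp).sub_const 1
      convert! (Real.hasDerivAt_log hu.1.ne').mul he using 1
      ring) (hi1.sub hi2) ?_ ?_
  · rw [intervalIntegral.integral_sub hi1 hi2] at h
    linarith
  · have h0 : Tendsto (fun u : ℝ => |u * Real.log u|) (nhdsWithin 0 (Set.Ioi 0)) (nhds 0) := by
      have : Tendsto (fun u : ℝ => |u * Real.log u|) (nhds 0) (nhds |0 * Real.log 0|) :=
        (Real.continuous_mul_log.abs).tendsto 0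
      simp only [zero_mul, abs_zero] at this
      exact this.mono_left nhdsWithin_le_nhds
    refine squeeze_zero_norm' ?_ h0
    filter_upwards [self_mem_nhdsWithin] with u hu
    have hu : 0 < u := hu
    rw [norm_mul, Real.norm_eq_abs, Real.norm_eq_abs, mul_comm, abs_mul, abs_of_pos hu]
    gcongr
    exact abs_exp_neg_sub_one_le hu.le
  · refine Tendsto.mono_left (ContinuousAt.tendsto ?_) nhdsWithin_le_nhds
    exact (Real.continuousAt_log hb.ne').mul (by fun_prop)

lemma abs_integral_exp_neg_sub_one_div_add_log_le {b : ℝ} (hb : 3 ≤ b) :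
    |(∫ u in (0 : ℝ)..b, (Real.exp (-u) - 1) / u) + Real.log b + Real.eulerMascheroniConstant|
      ≤ 2 * 5040 / b ^ 6 := by
  have hb0 : 0 < b := by linarith
  have hsub : Set.Ioi b ⊆ Set.Ioi 0 := Set.Ioi_subset_Ioi hb0.le
  have h := intervalIntegral.integral_interval_add_Ioi integrableOn_log_mul_exp_neg
    (integrableOn_log_mul_exp_neg.mono_set hsub)
  rw [integral_log_mul_exp_neg] at h
  have hint := (integrableOn_pow_mul_exp 7 one_pos)
  have htail : |∫ u in Set.Ioi b, Real.log u * Real.exp (-u)| ≤ 5040 / b ^ 6 := by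
    calc |∫ u in Set.Ioi b, Real.log u * Real.exp (-u)|
        ≤ ∫ u in Set.Ioi b, 1 / b ^ 6 * (u ^ 7 * Real.exp (-(1 * u))) := by
          rw [← Real.norm_eq_abs]
          refine norm_integral_le_of_norm_le (IntegrableOn.mono_set (hint.const_mul _) hsub) ?_
          filter_upwards [ae_restrict_mem measurableSet_Ioi] with u hu
          have hu : b < u := hu
          have hlog0 : 0 ≤ Real.log u := Real.log_nonneg (by linarith)
          have hlog : Real.log u ≤ u := by linarith [Real.log_le_sub_one_of_pos (hb0.trans hu)]
          rw [norm_mul, Real.norm_of_nonneg hlog0, Real.norm_of_nonneg (Real.exp_pos _).le,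
            ← mul_assoc, one_mul]
          gcongr
          refine hlog.trans ?_
          have : b ^ 6 ≤ u ^ 6 := pow_le_pow_left₀ hb0.le hu.le 6
          rw [div_mul_eq_mul_div, one_mul, le_div_iff₀ (by positivity)]
          calc u * b ^ 6 ≤ u * u ^ 6 := by
                have : 0 < u := hb0.trans hu
                gcongr
            _ = u ^ 7 := by ring
      _ ≤ ∫ u in Set.Ioi (0 : ℝ), 1 / b ^ 6 * (u ^ 7 * Real.exp (-(1 * u))) := by
          refine setIntegral_mono_set (hint.const_mul _) ?_ hsub.eventuallyLE
          filter_upwards [ae_restrict_mem measurableSet_Ioi] with k hk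
          have : (0 : ℝ) < k := hk
          positivity
      _ = 5040 / b ^ 6 := by
          rw [integral_const_mul, integral_pow_mul_exp 7 one_pos]
          norm_num [Nat.factorial]
          ring
  have hexp : |Real.log b * Real.exp (-b)| ≤ 5040 / b ^ 6 := by
    have hlog0 : 0 ≤ Real.log b := Real.log_nonneg (by linarith)
    have hlog : Real.log b ≤ b := by linarith [Real.log_le_sub_one_of_pos hb0]
    rw [abs_of_nonneg (by positivity), le_div_iff₀ (by positivity), Real.exp_neg]
    have h7 := Real.pow_div_factorial_le_exp b hb0.le 7
    rw [div_le_iff₀ (by positivity)] at h7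
    norm_num [Nat.factorial] at h7
    rw [← div_eq_mul_inv, div_mul_eq_mul_div, div_le_iff₀ (Real.exp_pos _)]
    calc Real.log b * b ^ 6 ≤ b * b ^ 6 := by gcongr
      _ = b ^ 7 := by ring
      _ ≤ _ := by linarith
  rw [integral_exp_neg_sub_one_div hb0]
  have e : Real.log b * (Real.exp (-b) - 1) + (∫ u in (0 : ℝ)..b, Real.log u * Real.exp (-u))
      + Real.log b + Real.eulerMascheroniConstant
      = Real.log b * Real.exp (-b) - ∫ u in Set.Ioi b, Real.log u * Real.exp (-u) := by
    linarith
  rw [e]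
  calc _ ≤ _ := abs_sub _ _
    _ ≤ _ := add_le_add hexp htail
    _ = _ := by ring

lemma abs_integral_exp_neg_mul_sub_one_div_le {y : ℝ} (hy : 1 ≤ y) :
    |(∫ k in (0 : ℝ)..Real.pi, (Real.exp (-(y * k)) - 1) / k) + Real.log y + Real.log Real.pi
        + Real.eulerMascheroniConstant| ≤ 2 * 5040 / y ^ 6 := by
  have hy0 : 0 < y := by linarith
  have h3 : 3 ≤ y * Real.pi := by nlinarith [Real.pi_gt_three]
  have h := abs_integral_exp_neg_sub_one_div_add_log_le h3
  have hs := intervalIntegral.integral_comp_mul_left (a := 0) (b := Real.pi)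
    (fun u : ℝ => (Real.exp (-u) - 1) / u) hy0.ne'
  have e : ∀ k : ℝ, (Real.exp (-(y * k)) - 1) / (y * k)
      = y⁻¹ * ((Real.exp (-(y * k)) - 1) / k) := by
    intro k
    rw [div_mul_eq_div_div_swap]
    ring
  simp_rw [e] at hs
  rw [intervalIntegral.integral_const_mul, smul_eq_mul, mul_zero] at hs
  have hs' := mul_left_cancel₀ (inv_ne_zero hy0.ne') hs
  rw [hs', add_assoc _ (Real.log y), ← Real.log_mul hy0.ne' Real.pi_ne_zero]
  refine h.trans ?_
  gcongr
  nlinarith [Real.pi_gt_three]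

lemma abs_cos_sub_one_le (x : ℝ) : |Real.cos x - 1| ≤ |x| := by
  simpa using Real.abs_cos_sub_cos_le x 0

lemma integrableOn_exp_mul_cos_sub_one_div (x : ℝ) {y : ℝ} (hy : 0 < y) :
    IntegrableOn (fun k : ℝ => Real.exp (-(y * k)) * (Real.cos (x * k) - 1) / k) (Set.Ioi 0) := by
  refine ((integrableOn_pow_mul_exp 0 hy).const_mul |x|).mono'
    (Measurable.aestronglyMeasurable (by fun_prop)) ?_
  filter_upwards [ae_restrict_mem measurableSet_Ioi] with k hk
  have hk : 0 < k := hk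
  rw [Real.norm_eq_abs, abs_div, abs_mul, abs_of_pos hk, abs_of_pos (Real.exp_pos _),
    div_le_iff₀ hk]
  have := abs_cos_sub_one_le (x * k)
  rw [abs_mul, abs_of_pos hk] at this
  calc _ ≤ Real.exp (-(y * k)) * (|x| * k) := by gcongr
    _ = _ := by ring

lemma integral_exp_mul_cos_sub_one_div (x : ℝ) {y : ℝ} (hy : 0 < y) :
    ∫ k in Set.Ioi (0 : ℝ), Real.exp (-(y * k)) * (Real.cos (x * k) - 1) / k
      = Real.log y - Real.log (x ^ 2 + y ^ 2) / 2 := by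
  set G : ℝ → ℝ := fun x => ∫ k in Set.Ioi (0 : ℝ), Real.exp (-(y * k)) * (Real.cos (x * k) - 1) / k
    with hG
  have hder : ∀ x, HasDerivAt G (-(x / (x ^ 2 + y ^ 2))) x := by
    intro x
    have h := (hasDerivAt_integral_of_dominated_loc_of_deriv_le (𝕜 := ℝ)
      (μ := volume.restrict (Set.Ioi (0 : ℝ))) (s := Set.univ) (x₀ := x)
      (F := fun x k => Real.exp (-(y * k)) * (Real.cos (x * k) - 1) / k)
      (F' := fun x k => -(Real.exp (-(y * k)) * Real.sin (x * k)))
      (bound := fun k => k ^ 0 * Real.exp (-(y * k))) univ_mem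
      (Eventually.of_forall fun x => Measurable.aestronglyMeasurable (by fun_prop))
      (integrableOn_exp_mul_cos_sub_one_div x hy)
      (Continuous.aestronglyMeasurable (by fun_prop))
      (Eventually.of_forall fun k x _ => ?_) (integrableOn_pow_mul_exp 0 hy) ?_).2
    · rw [integral_neg, integral_exp_mul_sin x hy] at h
      exact h
    · rw [norm_neg, norm_mul, Real.norm_of_nonneg (Real.exp_pos _).le, pow_zero, one_mul]
      exact mul_le_of_le_one_right (Real.exp_pos _).le (Real.abs_sin_le_one _)
    · filter_upwards [ae_restrict_mem measurableSet_Ioi] with k hk x _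
      have hk : k ≠ 0 := ne_of_gt hk
      convert! ((((hasDerivAt_id x).mul_const k).cos.sub_const 1).const_mul
        (Real.exp (-(y * k)))).div_const k using 1
      simp only [id]
      field_simp
  have hpos : ∀ x : ℝ, x ^ 2 + y ^ 2 ≠ 0 := fun x => by positivity
  have hder2 : ∀ x, HasDerivAt (fun x => G x + Real.log (x ^ 2 + y ^ 2) / 2) 0 x := by
    intro x
    have h := (hder x).add ((((hasDerivAt_pow 2 x).add_const (y ^ 2)).log (hpos x)).div_const 2)
    convert! h using 1
    field_simp
    norm_num
    ring
  have hc := is_const_of_deriv_eq_zero (fun x => (hder2 x).differentiableAt)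
    (fun x => (hder2 x).deriv) x 0
  have hG0 : G 0 = 0 := by simp [hG]
  simp only [hG0] at hc
  have : Real.log (0 ^ 2 + y ^ 2) = 2 * Real.log y := by
    rw [zero_pow two_ne_zero, zero_add, Real.log_pow]
    norm_num
  rw [this] at hc
  linarith

lemma decaySinh_eq {k : ℝ} (h0 : 0 ≤ k) (h1 : k ≤ Real.pi) :
    decaySinh k = 2 * Real.sin (k / 2) * Real.sqrt (1 + Real.sin (k / 2) ^ 2) := by
  have hs : 0 ≤ Real.sin (k / 2) :=
    Real.sin_nonneg_of_nonneg_of_le_pi (by linarith) (by linarith)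
  rw [decaySinh, cos_eq_one_sub_two_sin_half_sq k,
    show (1 - (1 - 2 * Real.sin (k / 2) ^ 2)) * (3 - (1 - 2 * Real.sin (k / 2) ^ 2))
      = (2 * Real.sin (k / 2)) ^ 2 * (1 + Real.sin (k / 2) ^ 2) by ring,
    Real.sqrt_mul (by positivity), Real.sqrt_sq (by positivity)]

lemma measurable_decaySinh : Measurable decaySinh := by
  unfold decaySinh
  fun_prop

lemma intervalIntegrable_inv_sub_inv_decaySinh :
    IntervalIntegrable (fun k : ℝ => k⁻¹ - (decaySinh k)⁻¹) volume 0 Real.pi := by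
  obtain ⟨C, hC, h⟩ := exists_inv_decaySinh_bound
  refine intervalIntegrable_of_abs_le (C := C * 4 ^ 5 + 20) Real.pi_pos.le
    (measurable_inv.sub measurable_decaySinh.inv) fun k h0 hkpi => ?_
  have hk4 : k ≤ 4 := hkpi.trans Real.pi_le_four
  have e : k⁻¹ - (decaySinh k)⁻¹ = (k / 12 - 43 * k ^ 3 / 1440)
      - ((decaySinh k)⁻¹ - (1 - k ^ 2 / 12 + 43 * k ^ 4 / 1440) / k) := by
    field_simp
    ring
  rw [e]
  refine (abs_sub _ _).trans ?_
  have h5 : C * k ^ 5 ≤ C * 4 ^ 5 := by gcongr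
  have h3 : |k / 12 - 43 * k ^ 3 / 1440| ≤ 20 := by
    have hk3 : k ^ 3 ≤ 4 ^ 3 := by gcongr
    have hk3' : 0 < k ^ 3 := by positivity
    rw [abs_le]
    constructor <;> linarith
  linarith [h k h0 hkpi]

lemma integral_inv_sub_inv_decaySinh :
    ∫ k in (0 : ℝ)..Real.pi, (k⁻¹ - (decaySinh k)⁻¹) = Real.log Real.pi - Real.log 8 / 2 := by
  have hsqrt2 : 0 < Real.sqrt 2 := by positivity
  have hlog2 : Real.log (Real.sqrt 2) = Real.log 2 / 2 := Real.log_sqrt (by norm_num)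
  have hlog8 : Real.log 8 = 3 * Real.log 2 := by
    rw [show (8 : ℝ) = 2 ^ 3 by norm_num, Real.log_pow]
    norm_num
  have h := intervalIntegral.integral_eq_sub_of_hasDerivAt_of_tendsto Real.pi_pos
    (f := fun k => -Real.log (Real.sin (k / 2) / k)
      + Real.log (Real.sqrt (1 + Real.sin (k / 2) ^ 2) + Real.cos (k / 2)))
    (fa := -Real.log (1 / 2) + Real.log (Real.sqrt (1 + Real.sin (0 / 2) ^ 2) + Real.cos (0 / 2)))
    (fb := -Real.log (Real.sin (Real.pi / 2) / Real.pi)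
      + Real.log (Real.sqrt (1 + Real.sin (Real.pi / 2) ^ 2) + Real.cos (Real.pi / 2)))
    (f' := fun k => k⁻¹ - (decaySinh k)⁻¹)
    (fun k hk => ?_) intervalIntegrable_inv_sub_inv_decaySinh ?_ ?_
  · rw [h]
    simp only [Real.sin_pi_div_two, Real.cos_pi_div_two, zero_div, Real.sin_zero, Real.cos_zero]
    have hhalf : Real.log (1 / 2) = -Real.log 2 := by rw [one_div, Real.log_inv]
    norm_num
    rw [hlog2, hlog8, hhalf]
    ring
  · have hs : 0 < Real.sin (k / 2) :=
      Real.sin_pos_of_pos_of_lt_pi (by linarith [hk.1]) (by linarith [hk.2, hk.1])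
    have hc : 0 < Real.cos (k / 2) :=
      Real.cos_pos_of_mem_Ioo ⟨by linarith [hk.1, Real.pi_pos], by linarith [hk.2]⟩
    have hk0 : 0 < k := hk.1
    have hsc := Real.sin_sq_add_cos_sq (k / 2)
    have hw : 0 < 1 + Real.sin (k / 2) ^ 2 := by positivity
    have hds : HasDerivAt (fun k : ℝ => Real.sin (k / 2)) (Real.cos (k / 2) * (1 / 2)) k :=
      ((hasDerivAt_id k).div_const 2).sin
    have hdc : HasDerivAt (fun k : ℝ => Real.cos (k / 2)) (-Real.sin (k / 2) * (1 / 2)) k :=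
      ((hasDerivAt_id k).div_const 2).cos
    have hw0 : 0 < Real.sqrt (1 + Real.sin (k / 2) ^ 2) := Real.sqrt_pos.2 hw
    have h1 := ((hds.div (hasDerivAt_id k) hk0.ne').log (by
      exact div_ne_zero hs.ne' hk0.ne')).neg
    have h2 := ((((hds.pow 2).const_add 1).sqrt hw.ne').add hdc).log (by
      simp only [Pi.add_apply, Pi.pow_apply]
      positivity)
    convert! h1.add h2 using 1
    rw [decaySinh_eq hk0.le hk.2.le]
    simp only [Pi.add_apply, Pi.pow_apply, Pi.div_apply, id]
    have hwsq : Real.sqrt (1 + Real.sin (k / 2) ^ 2) ^ 2 = 1 + Real.sin (k / 2) ^ 2 :=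
      Real.sq_sqrt hw.le
    generalize Real.sqrt (1 + Real.sin (k / 2) ^ 2) = w at *
    generalize Real.sin (k / 2) = s at *
    generalize Real.cos (k / 2) = c at *
    have hwc : 0 < w + c := by positivity
    have hc2 : c ^ 2 = 1 - s ^ 2 := by linarith
    field_simp
    norm_num
    linear_combination 2 * k * c * hwsq + 2 * k * w * hc2
  · have hslope : Tendsto (fun k : ℝ => Real.sin (k / 2) / k) (nhdsWithin 0 (Set.Ioi 0))
        (nhds (1 / 2)) := by
      have hds : HasDerivAt (fun k : ℝ => Real.sin (k / 2)) (Real.cos (0 / 2) * (1 / 2)) 0 :=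
        ((hasDerivAt_id (0 : ℝ)).div_const 2).sin
      have := hds.tendsto_slope_zero_right
      simpa [div_eq_inv_mul] using this
    refine ((hslope.log (by norm_num)).neg).add (Tendsto.mono_left (ContinuousAt.tendsto
      (ContinuousAt.log (by fun_prop) ?_)) nhdsWithin_le_nhds)
    norm_num
  · refine Tendsto.mono_left (ContinuousAt.tendsto ?_) nhdsWithin_le_nhds
    refine ContinuousAt.add (ContinuousAt.neg (ContinuousAt.log ?_ ?_))
      (ContinuousAt.log (by fun_prop) ?_)
    · exact ContinuousAt.div (by fun_prop) continuousAt_id Real.pi_ne_zero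
    · rw [Real.sin_pi_div_two]
      exact div_ne_zero one_ne_zero Real.pi_ne_zero
    · rw [Real.sin_pi_div_two, Real.cos_pi_div_two]
      norm_num

lemma poisson_denom_pos {s : ℝ} (hs : 0 < s) (t : ℝ) : 0 < 2 * Real.cosh s - 2 * Real.cos t := by
  have h1 := Real.one_lt_cosh.2 hs.ne'
  have h2 := Real.cos_le_one t
  linarith

lemma intervalIntegrable_div_poisson_denom {s : ℝ} (hs : 0 < s) {f : ℝ → ℝ} (hf : Continuous f)
    (a b : ℝ) :
    IntervalIntegrable (fun t => f t / (2 * Real.cosh s - 2 * Real.cos t)) volume a b :=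
  (hf.div (by fun_prop) fun t => (poisson_denom_pos hs t).ne').intervalIntegrable a b

lemma integral_cos_nat_mul_eq_zero {n : ℕ} (hn : n ≠ 0) :
    ∫ t in (-Real.pi)..Real.pi, Real.cos (n * t) = 0 := by
  have hn' : (n : ℝ) ≠ 0 := Nat.cast_ne_zero.2 hn
  rw [intervalIntegral.integral_comp_mul_left (fun t => Real.cos t) hn', integral_cos]
  simp [Real.sin_nat_mul_pi]

/-- Fourier coefficients of the Poisson kernel. -/
lemma integral_cos_div_poisson_denom {s : ℝ} (hs : 0 < s) (n : ℕ) :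
    ∫ t in (-Real.pi)..Real.pi, Real.cos (n * t) / (2 * Real.cosh s - 2 * Real.cos t)
      = Real.pi * Real.exp (-(n * s)) / Real.sinh s := by
  set I : ℕ → ℝ := fun n =>
    ∫ t in (-Real.pi)..Real.pi, Real.cos (n * t) / (2 * Real.cosh s - 2 * Real.cos t) with hI
  have hii : ∀ n : ℕ, IntervalIntegrable
      (fun t => Real.cos (n * t) / (2 * Real.cosh s - 2 * Real.cos t)) volume
      (-Real.pi) Real.pi := fun n =>
    intervalIntegrable_div_poisson_denom hs (by fun_prop) _ _
  have hsinh : 0 < Real.sinh s := Real.sinh_pos_iff.2 hs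
  have hpi := Real.pi_pos
  have hone : 2 * Real.cosh s * I 0 - 2 * I 1 = 2 * Real.pi := by
    have : ∫ t in (-Real.pi)..Real.pi,
        (2 * Real.cosh s * (Real.cos ((0 : ℕ) * t) / (2 * Real.cosh s - 2 * Real.cos t))
        - 2 * (Real.cos ((1 : ℕ) * t) / (2 * Real.cosh s - 2 * Real.cos t)))
        = 2 * Real.pi := by
      rw [intervalIntegral.integral_congr (g := fun _ => (1 : ℝ))]
      · simp
        ring
      · intro t _
        have := (poisson_denom_pos hs t).ne'
        simp only [Nat.cast_zero, zero_mul, Real.cos_zero, Nat.cast_one, one_mul]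
        rw [← mul_div_assoc, ← mul_div_assoc, ← sub_div, mul_one, div_self this]
    rw [intervalIntegral.integral_sub ((hii 0).const_mul _) ((hii 1).const_mul _),
      intervalIntegral.integral_const_mul, intervalIntegral.integral_const_mul] at this
    exact this
  have hrec : ∀ n, I (n + 2) = 2 * Real.cosh s * I (n + 1) - I n := by
    intro n
    have : ∫ t in (-Real.pi)..Real.pi,
        (2 * Real.cosh s * (Real.cos ((n + 1 : ℕ) * t) / (2 * Real.cosh s - 2 * Real.cos t))
        - Real.cos (n * t) / (2 * Real.cosh s - 2 * Real.cos t)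
        - Real.cos ((n + 2 : ℕ) * t) / (2 * Real.cosh s - 2 * Real.cos t)) = 0 := by
      rw [← integral_cos_nat_mul_eq_zero n.succ_ne_zero]
      refine intervalIntegral.integral_congr fun t _ => ?_
      have := (poisson_denom_pos hs t).ne'
      have e1 : Real.cos ((n + 2 : ℕ) * t) + Real.cos (n * t)
          = 2 * Real.cos ((n + 1 : ℕ) * t) * Real.cos t := by
        rw [show ((n + 2 : ℕ) : ℝ) * t = (n + 1 : ℕ) * t + t by push_cast; ring,
          show (n : ℝ) * t = (n + 1 : ℕ) * t - t by push_cast; ring, Real.cos_add, Real.cos_sub]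
        ring
      simp only [Nat.succ_eq_add_one]
      rw [← mul_div_assoc, ← sub_div, ← sub_div, div_eq_iff this]
      linear_combination -e1
    rw [intervalIntegral.integral_sub (((hii (n + 1)).const_mul _).sub (hii n)) (hii (n + 2)),
      intervalIntegral.integral_sub ((hii (n + 1)).const_mul _) (hii n),
      intervalIntegral.integral_const_mul] at this
    simp only [hI]
    linarith
  have hbound : ∀ n, |I n| ≤ I 0 := by
    intro n
    simp only [hI]
    refine (intervalIntegral.abs_integral_le_integral_abs (by linarith)).trans ?_
    refine intervalIntegral.integral_mono_on (by linarith) (hii n).abs (hii 0) fun t _ => ?_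
    rw [abs_div, abs_of_pos (poisson_denom_pos hs t)]
    have := (poisson_denom_pos hs t).le
    gcongr
    simpa using Real.abs_cos_le_one _
  have hr : Real.exp (-s) = Real.cosh s - Real.sinh s := by rw [Real.cosh_sub_sinh]
  have hr' : Real.exp s = Real.cosh s + Real.sinh s := by rw [Real.cosh_add_sinh]
  have hrr : Real.exp s * Real.exp (-s) = 1 := by rw [← Real.exp_add]; simp
  have hgrow : ∀ n : ℕ, I (n + 1) - Real.exp (-s) * I n
      = Real.exp s ^ n * (I 1 - Real.exp (-s) * I 0) := by
    intro n
    induction n with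
    | zero => simp
    | succ n ih =>
      rw [pow_succ, mul_right_comm, ← ih, hrec]
      have : 2 * Real.cosh s = Real.exp s + Real.exp (-s) := by rw [hr, hr']; ring
      rw [this]
      linear_combination I n * hrr
  have hstart : I 1 - Real.exp (-s) * I 0 = 0 := by
    by_contra hne
    have htend := tendsto_pow_atTop_atTop_of_one_lt (Real.one_lt_exp_iff.2 hs)
    obtain ⟨n, hn⟩ := (htend.eventually_gt_atTop
      ((2 * I 0) / |I 1 - Real.exp (-s) * I 0|)).exists
    rw [div_lt_iff₀ (abs_pos.2 hne)] at hn
    have h1 : |I (n + 1) - Real.exp (-s) * I n| ≤ 2 * I 0 := by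
      refine (abs_sub _ _).trans ?_
      rw [abs_mul, abs_of_pos (Real.exp_pos _)]
      have he : Real.exp (-s) ≤ 1 := Real.exp_le_one_iff.2 (by linarith)
      have := mul_le_mul he (hbound n) (abs_nonneg _) zero_le_one
      linarith [hbound (n + 1)]
    rw [hgrow, abs_mul, abs_of_pos (by positivity)] at h1
    linarith
  have hgeom : ∀ n : ℕ, I n = Real.exp (-(n * s)) * I 0 := by
    intro n
    induction n with
    | zero => simp
    | succ n ih =>
      have := hgrow n
      rw [hstart, mul_zero, ih] at this
      rw [sub_eq_zero.1 this, ← mul_assoc, ← Real.exp_add]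
      congr 2
      push_cast
      ring
  have hzero : I 0 = Real.pi / Real.sinh s := by
    rw [eq_div_iff hsinh.ne']
    have := sub_eq_zero.1 hstart
    rw [this, hr] at hone
    linarith
  change I n = _
  rw [hgeom, hzero]
  ring

lemma integral_cos_int_div_poisson_denom {s : ℝ} (hs : 0 < s) (n : ℤ) :
    ∫ t in (-Real.pi)..Real.pi, Real.cos (t * n) / (2 * Real.cosh s - 2 * Real.cos t)
      = Real.pi * Real.exp (-(|(n : ℝ)| * s)) / Real.sinh s := by
  have h := integral_cos_div_poisson_denom hs n.natAbs
  have hcast : ((n.natAbs : ℕ) : ℝ) = |(n : ℝ)| := by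
    rw [Nat.cast_natAbs, Int.cast_abs]
  rw [hcast] at h
  rw [← h]
  refine intervalIntegral.integral_congr fun t _ => ?_
  rcases abs_choice (n : ℝ) with h' | h' <;> rw [h', mul_comm t]
  rw [neg_mul, Real.cos_neg]

lemma intervalIntegral_eq_zero_of_odd {f : ℝ → ℝ} (hf : ∀ t, f (-t) = -f t) (a : ℝ) :
    ∫ t in (-a)..a, f t = 0 := by
  have h := intervalIntegral.integral_comp_neg (a := -a) (b := a) f
  simp only [hf, intervalIntegral.integral_neg, neg_neg] at h
  linarith

lemma intervalIntegral_eq_two_mul_of_even {f : ℝ → ℝ} (hf : ∀ t, f (-t) = f t) {a : ℝ}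
    (hi : IntervalIntegrable f volume (-a) a) (ha : 0 ≤ a) :
    ∫ t in (-a)..a, f t = 2 * ∫ t in (0 : ℝ)..a, f t := by
  have h := intervalIntegral.integral_comp_neg (a := 0) (b := a) f
  simp only [hf, neg_zero] at h
  rw [← intervalIntegral.integral_add_adjacent_intervals (b := 0), ← h, two_mul]
  · exact hi.mono_set (Set.uIcc_subset_uIcc_left (by simp [ha]))
  · exact hi.mono_set (Set.uIcc_subset_uIcc_right (by simp [ha]))

lemma latticeKernel_eq (m : ℤ × ℤ) (k t : ℝ) :
    latticeKernel m (k, t) = (Real.cos (k * m.1 + t * m.2) - 1) /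
      (2 * Real.cosh (decayRate k) - 2 * Real.cos t) := by
  rw [latticeKernel, cosh_decayRate, cos_eq_one_sub_two_sin_half_sq k,
    cos_eq_one_sub_two_sin_half_sq t]
  congr 1
  ring

lemma integral_latticeKernel (m : ℤ × ℤ) {k : ℝ} (h0 : 0 < k) (h1 : k ≤ Real.pi) :
    ∫ t in (-Real.pi)..Real.pi, latticeKernel m (k, t)
      = Real.pi * ((Real.exp (-(|(m.2 : ℝ)| * decayRate k)) * Real.cos (m.1 * k) - 1)
        / decaySinh k) := by
  have hs : 0 < decayRate k := lt_of_lt_of_le (by positivity) (div_le_decayRate h0.le h1)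
  have hcos := integral_cos_int_div_poisson_denom hs m.2
  have hone := integral_cos_int_div_poisson_denom hs 0
  have hsin : ∫ t in (-Real.pi)..Real.pi,
      Real.sin (t * m.2) / (2 * Real.cosh (decayRate k) - 2 * Real.cos t) = 0 :=
    intervalIntegral_eq_zero_of_odd (fun t => by
      rw [neg_mul, Real.sin_neg, Real.cos_neg, neg_div]) _
  have e : ∀ t, latticeKernel m (k, t)
      = Real.cos (k * m.1) *
          (Real.cos (t * m.2) / (2 * Real.cosh (decayRate k) - 2 * Real.cos t))
        - Real.sin (k * m.1) *
          (Real.sin (t * m.2) / (2 * Real.cosh (decayRate k) - 2 * Real.cos t))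
        - Real.cos (t * (0 : ℤ)) / (2 * Real.cosh (decayRate k) - 2 * Real.cos t) := by
    intro t
    rw [latticeKernel_eq, Real.cos_add]
    simp only [Int.cast_zero, mul_zero, Real.cos_zero]
    ring
  have i1 := intervalIntegrable_div_poisson_denom hs
    (f := fun t => Real.cos (t * m.2)) (by fun_prop) (-Real.pi) Real.pi
  have i2 := intervalIntegrable_div_poisson_denom hs
    (f := fun t => Real.sin (t * m.2)) (by fun_prop) (-Real.pi) Real.pi
  have i3 := intervalIntegrable_div_poisson_denom hs
    (f := fun t => Real.cos (t * (0 : ℤ))) (by fun_prop) (-Real.pi) Real.pi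
  simp only [e]
  rw [intervalIntegral.integral_sub ((i1.const_mul _).sub (i2.const_mul _)) i3,
    intervalIntegral.integral_sub (i1.const_mul _) (i2.const_mul _),
    intervalIntegral.integral_const_mul, intervalIntegral.integral_const_mul, hcos, hsin, hone,
    sinh_decayRate h0.le h1, mul_comm k]
  simp only [Int.cast_zero, abs_zero, zero_mul, neg_zero, Real.exp_zero]
  ring

lemma integrableOn_latticeKernel (m : ℤ × ℤ) :
    IntegrableOn (latticeKernel m)
      (Set.Icc (-Real.pi) Real.pi ×ˢ Set.Icc (-Real.pi) Real.pi) := by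
  have hmeas : Measurable (latticeKernel m) := by
    unfold latticeKernel
    fun_prop
  refine Measure.integrableOn_of_bounded
    (M := Real.pi ^ 2 / 4 * ((m.1 : ℝ) ^ 2 + (m.2 : ℝ) ^ 2)) ?_ hmeas.aestronglyMeasurable ?_
  · exact ((isCompact_Icc.prod isCompact_Icc).measure_lt_top).ne
  · filter_upwards [ae_restrict_mem (measurableSet_Icc.prod measurableSet_Icc)] with t ht
    have hsq : ∀ u ∈ Set.Icc (-Real.pi) Real.pi,
        4 / Real.pi ^ 2 * u ^ 2 ≤ 4 * Real.sin (u / 2) ^ 2 := by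
      intro u hu
      have hu2 : |u / 2| ≤ Real.pi / 2 := by
        rw [abs_le]
        constructor <;> linarith [hu.1, hu.2]
      have h := Real.mul_abs_le_abs_sin hu2
      have h' := pow_le_pow_left₀ (by positivity) h 2
      rw [mul_pow, sq_abs, sq_abs] at h'
      have hpi := Real.pi_ne_zero
      calc 4 / Real.pi ^ 2 * u ^ 2 = 4 * ((2 / Real.pi) ^ 2 * (u / 2) ^ 2) := by
            field_simp
        _ ≤ _ := by linarith
    have h1 := hsq _ ht.1
    have h2 := hsq _ ht.2
    set q := t.1 ^ 2 + t.2 ^ 2 with hq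
    have hden : 4 / Real.pi ^ 2 * q ≤ 4 * Real.sin (t.1 / 2) ^ 2 + 4 * Real.sin (t.2 / 2) ^ 2 := by
      rw [hq, mul_add]
      exact add_le_add h1 h2
    have hnum : |Real.cos (t.1 * m.1 + t.2 * m.2) - 1|
        ≤ q * ((m.1 : ℝ) ^ 2 + (m.2 : ℝ) ^ 2) / 2 := by
      have h3 := Real.one_sub_sq_div_two_le_cos (x := t.1 * m.1 + t.2 * m.2)
      rw [abs_sub_comm, abs_of_nonneg (by linarith [Real.cos_le_one (t.1 * m.1 + t.2 * m.2)])]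
      have h4 : (t.1 * m.1 + t.2 * m.2) ^ 2 ≤ q * ((m.1 : ℝ) ^ 2 + (m.2 : ℝ) ^ 2) := by
        rw [hq]
        nlinarith [sq_nonneg (t.1 * m.2 - t.2 * m.1)]
      linarith
    have hpi := Real.pi_pos
    rw [Real.norm_eq_abs, latticeKernel, abs_div, abs_of_nonneg (a := 4 * _ + _) (by positivity)]
    refine div_le_of_le_mul₀ (by positivity) (by positivity) (hnum.trans ?_)
    have hM : 0 ≤ Real.pi ^ 2 / 4 * ((m.1 : ℝ) ^ 2 + (m.2 : ℝ) ^ 2) := by positivity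
    refine le_trans ?_ (mul_le_mul_of_nonneg_left hden hM)
    have : Real.pi ^ 2 / 4 * ((m.1 : ℝ) ^ 2 + (m.2 : ℝ) ^ 2) * (4 / Real.pi ^ 2 * q)
        = q * ((m.1 : ℝ) ^ 2 + (m.2 : ℝ) ^ 2) := by
      field_simp
    rw [this]
    have : 0 ≤ q * ((m.1 : ℝ) ^ 2 + (m.2 : ℝ) ^ 2) := by positivity
    linarith

lemma phi_eq_integral (m : ℤ × ℤ) :
    phi m = 1 / (2 * Real.pi) * ∫ k in (0 : ℝ)..Real.pi,
      (Real.exp (-(|(m.2 : ℝ)| * decayRate k)) * Real.cos (m.1 * k) - 1) / decaySinh k := by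
  have hpi := Real.pi_pos
  have hle : -Real.pi ≤ Real.pi := by linarith
  have hint := integrableOn_latticeKernel m
  have hout : IntervalIntegrable (fun k => ∫ t in (-Real.pi)..Real.pi, latticeKernel m (k, t))
      volume (-Real.pi) Real.pi := by
    rw [intervalIntegrable_iff_integrableOn_Icc_of_le hle]
    have h := hint
    rw [IntegrableOn, Measure.volume_eq_prod, ← Measure.prod_restrict] at h
    simpa only [IntegrableOn, intervalIntegral.integral_of_le hle, ← integral_Icc_eq_integral_Ioc]
      using h.integral_prod_left
  have heven : ∀ k, ∫ t in (-Real.pi)..Real.pi, latticeKernel m (-k, t)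
      = ∫ t in (-Real.pi)..Real.pi, latticeKernel m (k, t) := by
    intro k
    have h := intervalIntegral.integral_comp_neg (a := -Real.pi) (b := Real.pi)
      (fun t => latticeKernel m (-k, t))
    rw [neg_neg] at h
    rw [← h]
    refine intervalIntegral.integral_congr fun t _ => ?_
    simp only [latticeKernel, neg_mul, neg_div, Real.sin_neg, neg_sq]
    rw [← neg_add, Real.cos_neg]
  rw [phi, Measure.volume_eq_prod, setIntegral_prod _ hint]
  simp only [integral_Icc_eq_integral_Ioc, ← intervalIntegral.integral_of_le hle]
  rw [intervalIntegral_eq_two_mul_of_even heven hout hpi.le,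
    intervalIntegral.integral_congr_ae (g := fun k => Real.pi *
      ((Real.exp (-(|(m.2 : ℝ)| * decayRate k)) * Real.cos (m.1 * k) - 1) / decaySinh k)),
    intervalIntegral.integral_const_mul]
  · field_simp
  · refine Filter.Eventually.of_forall fun k hk => ?_
    rw [Set.uIoc_of_le hpi.le] at hk
    exact integral_latticeKernel m hk.1 hk.2

lemma phi_swap (m : ℤ × ℤ) : phi m.swap = phi m := by
  rw [phi, phi, Measure.volume_eq_prod, ← setIntegral_prod_swap]
  congr 2
  ext t
  simp only [latticeKernel, Prod.fst_swap, Prod.snd_swap]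
  rw [add_comm (t.2 * _), add_comm (4 * _)]

/-- The first-order correction to the logarithm, together with the second-order one, as a rational
function of the lattice coordinates. -/
noncomputable def rationalPart (x y : ℝ) : ℝ :=
  (x ^ 4 - 6 * x ^ 2 * y ^ 2 + y ^ 4) / (12 * (x ^ 2 + y ^ 2) ^ 3)
    + (43 * x ^ 8 - 772 * x ^ 6 * y ^ 2 + 1570 * x ^ 4 * y ^ 4 - 772 * x ^ 2 * y ^ 6 + 43 * y ^ 8)
      / (240 * (x ^ 2 + y ^ 2) ^ 6)

lemma integral_Ioi_sub_integral_interval {f : ℝ → ℝ} (hf : IntegrableOn f (Set.Ioi 0)) :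
    (∫ k in (0 : ℝ)..Real.pi, f k) - ∫ k in Set.Ioi 0, f k = -∫ k in Set.Ioi Real.pi, f k := by
  have h := intervalIntegral.integral_interval_add_Ioi hf
    (hf.mono_set (Set.Ioi_subset_Ioi Real.pi_pos.le))
  linarith

lemma intervalIntegrable_of_integrableOn_Ioi {f : ℝ → ℝ} (hf : IntegrableOn f (Set.Ioi 0)) :
    IntervalIntegrable f volume 0 Real.pi := by
  rw [intervalIntegrable_iff_integrableOn_Ioc_of_le Real.pi_pos.le]
  exact hf.mono_set Set.Ioc_subset_Ioi_self

lemma abs_integral_pow_mul_exp_mul_cos_sub_le {j : ℕ} (hj : j ≤ 7) (x : ℝ) {y : ℝ} (hy : 0 < y) :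
    |(∫ k in (0 : ℝ)..Real.pi, k ^ j * (Real.exp (-(y * k)) * Real.cos (x * k)))
      - j.factorial * ((y + x * Complex.I) ^ (j + 1) : ℂ).re / (x ^ 2 + y ^ 2) ^ (j + 1)|
      ≤ 5040 / y ^ 8 := by
  rw [← integral_pow_mul_exp_mul_cos j x hy,
    integral_Ioi_sub_integral_interval (integrableOn_pow_mul_exp_mul_cos j x hy), abs_neg]
  refine (abs_setIntegral_Ioi_pi_le (A := 1) 7 hy fun k hk => ?_).trans (by norm_num [Nat.factorial])
  have hk0 : 0 ≤ k := by linarith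
  rw [abs_mul, abs_mul, abs_of_nonneg (pow_nonneg hk0 j), abs_of_pos (Real.exp_pos _), one_mul]
  gcongr
  exact mul_le_of_le_one_right (Real.exp_pos _).le (Real.abs_cos_le_one _)

lemma abs_integral_exp_mul_cos_sub_one_div_sub_le (x : ℝ) {y : ℝ} (hy : 0 < y) :
    |(∫ k in (0 : ℝ)..Real.pi, Real.exp (-(y * k)) * (Real.cos (x * k) - 1) / k)
      - (Real.log y - Real.log (x ^ 2 + y ^ 2) / 2)| ≤ 240 / y ^ 6 := by
  rw [← integral_exp_mul_cos_sub_one_div x hy,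
    integral_Ioi_sub_integral_interval (integrableOn_exp_mul_cos_sub_one_div x hy), abs_neg]
  refine (abs_setIntegral_Ioi_pi_le (A := 2) 5 hy fun k hk => ?_).trans
    (le_of_eq (by norm_num [Nat.factorial]; ring))
  have hk0 : 0 < k := by linarith
  have hc : |Real.cos (x * k) - 1| ≤ 2 := by
    rw [abs_le]
    constructor <;> linarith [Real.neg_one_le_cos (x * k), Real.cos_le_one (x * k)]
  rw [abs_div, abs_mul, abs_of_pos (Real.exp_pos _), abs_of_pos hk0, div_le_iff₀ hk0]
  have h6 : 1 ≤ k ^ 6 := one_le_pow₀ hk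
  calc _ ≤ Real.exp (-(y * k)) * 2 := by gcongr
    _ ≤ Real.exp (-(y * k)) * 2 * k ^ 6 := le_mul_of_one_le_right (by positivity) h6
    _ = _ := by ring

/-- The part of the integrand produced by the nonconstant terms of `approxPoly`. -/
noncomputable def polyIntegrand (x y k : ℝ) : ℝ :=
  Real.exp (-(y * k)) * Real.cos (x * k) * ((approxPoly y k - 1) / k)

lemma polyIntegrand_eq (x y : ℝ) {k : ℝ} (hk : k ≠ 0) :
    polyIntegrand x y k =
      -(1 / 12) * (k ^ 1 * (Real.exp (-(y * k)) * Real.cos (x * k)))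
      + y / 12 * (k ^ 2 * (Real.exp (-(y * k)) * Real.cos (x * k)))
      + 43 / 1440 * (k ^ 3 * (Real.exp (-(y * k)) * Real.cos (x * k)))
      + -(5 * y / 288) * (k ^ 4 * (Real.exp (-(y * k)) * Real.cos (x * k)))
      + y ^ 2 / 288 * (k ^ 5 * (Real.exp (-(y * k)) * Real.cos (x * k))) := by
  rw [polyIntegrand, approxPoly]
  field_simp
  ring

lemma rationalPart_eq (x : ℝ) {y : ℝ} (hy : 0 < y) :
    rationalPart x y =
      -(1 / 12) * ((1).factorial * ((y + x * Complex.I) ^ (1 + 1) : ℂ).re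
        / (x ^ 2 + y ^ 2) ^ (1 + 1))
      + y / 12 * ((2).factorial * ((y + x * Complex.I) ^ (2 + 1) : ℂ).re
        / (x ^ 2 + y ^ 2) ^ (2 + 1))
      + 43 / 1440 * ((3).factorial * ((y + x * Complex.I) ^ (3 + 1) : ℂ).re
        / (x ^ 2 + y ^ 2) ^ (3 + 1))
      + -(5 * y / 288) * ((4).factorial * ((y + x * Complex.I) ^ (4 + 1) : ℂ).re
        / (x ^ 2 + y ^ 2) ^ (4 + 1))
      + y ^ 2 / 288 * ((5).factorial * ((y + x * Complex.I) ^ (5 + 1) : ℂ).re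
        / (x ^ 2 + y ^ 2) ^ (5 + 1)) := by
  have hR : x ^ 2 + y ^ 2 ≠ 0 := by positivity
  have hre : ∀ n : ℕ, ((y + x * Complex.I) ^ (n + 1) : ℂ).re
      = ((y + x * Complex.I) ^ n : ℂ).re * y - ((y + x * Complex.I) ^ n : ℂ).im * x := fun n => by
    rw [pow_succ, Complex.mul_re]
    simp
  have him : ∀ n : ℕ, ((y + x * Complex.I) ^ (n + 1) : ℂ).im
      = ((y + x * Complex.I) ^ n : ℂ).re * x + ((y + x * Complex.I) ^ n : ℂ).im * y := fun n => by
    rw [pow_succ, Complex.mul_im]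
    simp
  have h0 : ((y + x * Complex.I) ^ 0 : ℂ).re = 1 := by simp
  have h0' : ((y + x * Complex.I) ^ 0 : ℂ).im = 0 := by simp
  rw [show ((y + x * Complex.I) ^ (1 + 1) : ℂ) = (y + x * Complex.I) ^ (0 + 1 + 1) from rfl,
    show ((y + x * Complex.I) ^ (2 + 1) : ℂ) = (y + x * Complex.I) ^ (0 + 1 + 1 + 1) from rfl,
    show ((y + x * Complex.I) ^ (3 + 1) : ℂ) = (y + x * Complex.I) ^ (0 + 1 + 1 + 1 + 1) from rfl,
    show ((y + x * Complex.I) ^ (4 + 1) : ℂ)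
      = (y + x * Complex.I) ^ (0 + 1 + 1 + 1 + 1 + 1) from rfl,
    show ((y + x * Complex.I) ^ (5 + 1) : ℂ)
      = (y + x * Complex.I) ^ (0 + 1 + 1 + 1 + 1 + 1 + 1) from rfl]
  simp only [hre, him, h0, h0', rationalPart, Nat.factorial, Nat.succ_eq_add_one]
  push_cast
  field_simp
  ring

lemma intervalIntegrable_polyIntegrand (x : ℝ) {y : ℝ} (hy : 0 < y) :
    IntervalIntegrable (polyIntegrand x y) volume 0 Real.pi := by
  have hi : ∀ j : ℕ, IntervalIntegrable
      (fun k => k ^ j * (Real.exp (-(y * k)) * Real.cos (x * k))) volume 0 Real.pi := fun j =>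
    intervalIntegrable_of_integrableOn_Ioi (integrableOn_pow_mul_exp_mul_cos j x hy)
  refine (((((hi 1).const_mul (-(1 / 12))).add ((hi 2).const_mul (y / 12))).add
    ((hi 3).const_mul (43 / 1440))).add ((hi 4).const_mul (-(5 * y / 288)))).add
    ((hi 5).const_mul (y ^ 2 / 288)) |>.congr fun k hk => ?_
  rw [Set.uIoc_of_le Real.pi_pos.le] at hk
  exact (polyIntegrand_eq x y hk.1.ne').symm

lemma abs_integral_polyIntegrand_sub_le (x : ℝ) {y : ℝ} (hy : 1 ≤ y) :
    |(∫ k in (0 : ℝ)..Real.pi, polyIntegrand x y k) - rationalPart x y| ≤ 5 * 5040 / y ^ 6 := by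
  have hy0 : 0 < y := by linarith
  have hi : ∀ j : ℕ, IntervalIntegrable
      (fun k => k ^ j * (Real.exp (-(y * k)) * Real.cos (x * k))) volume 0 Real.pi := fun j =>
    intervalIntegrable_of_integrableOn_Ioi (integrableOn_pow_mul_exp_mul_cos j x hy0)
  have hterm : ∀ (c : ℝ) {j : ℕ}, j ≤ 7 → |c| ≤ y ^ 2 →
      |c * (∫ k in (0 : ℝ)..Real.pi, k ^ j * (Real.exp (-(y * k)) * Real.cos (x * k)))
        - c * (j.factorial * ((y + x * Complex.I) ^ (j + 1) : ℂ).re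
          / (x ^ 2 + y ^ 2) ^ (j + 1))| ≤ 5040 / y ^ 6 := by
    intro c j hj hc
    rw [← mul_sub, abs_mul]
    refine (mul_le_mul hc (abs_integral_pow_mul_exp_mul_cos_sub_le hj x hy0) (abs_nonneg _)
      (by positivity)).trans (le_of_eq ?_)
    field_simp
  have hyy : y ≤ y ^ 2 := by nlinarith
  have h1 := hterm (-(1 / 12)) (j := 1) (by norm_num)
    (by rw [abs_neg, abs_of_pos] <;> linarith)
  have h2 := hterm (y / 12) (j := 2) (by norm_num) (by rw [abs_of_pos] <;> linarith)
  have h3 := hterm (43 / 1440) (j := 3) (by norm_num) (by rw [abs_of_pos] <;> linarith)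
  have h4 := hterm (-(5 * y / 288)) (j := 4) (by norm_num)
    (by rw [abs_neg, abs_of_pos] <;> linarith)
  have h5 := hterm (y ^ 2 / 288) (j := 5) (by norm_num) (by rw [abs_of_pos] <;> nlinarith)
  rw [rationalPart_eq x hy0, intervalIntegral.integral_congr_ae
    (g := fun k => -(1 / 12) * (k ^ 1 * (Real.exp (-(y * k)) * Real.cos (x * k)))
      + y / 12 * (k ^ 2 * (Real.exp (-(y * k)) * Real.cos (x * k)))
      + 43 / 1440 * (k ^ 3 * (Real.exp (-(y * k)) * Real.cos (x * k)))
      + -(5 * y / 288) * (k ^ 4 * (Real.exp (-(y * k)) * Real.cos (x * k)))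
      + y ^ 2 / 288 * (k ^ 5 * (Real.exp (-(y * k)) * Real.cos (x * k))))
    (Filter.Eventually.of_forall fun k hk => by
      rw [Set.uIoc_of_le Real.pi_pos.le] at hk
      exact polyIntegrand_eq x y hk.1.ne'),
    intervalIntegral.integral_add (((((hi 1).const_mul _).add ((hi 2).const_mul _)).add
      ((hi 3).const_mul _)).add ((hi 4).const_mul _)) ((hi 5).const_mul _),
    intervalIntegral.integral_add ((((hi 1).const_mul _).add ((hi 2).const_mul _)).add
      ((hi 3).const_mul _)) ((hi 4).const_mul _),
    intervalIntegral.integral_add (((hi 1).const_mul _).add ((hi 2).const_mul _))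
      ((hi 3).const_mul _),
    intervalIntegral.integral_add ((hi 1).const_mul _) ((hi 2).const_mul _)]
  simp only [intervalIntegral.integral_const_mul]
  rw [abs_le] at h1 h2 h3 h4 h5 ⊢
  rw [mul_div_assoc]
  constructor <;> linarith [h1.1, h1.2, h2.1, h2.2, h3.1, h3.2, h4.1, h4.2, h5.1, h5.2]

/-- The error made by replacing the integrand by its local approximation. -/
noncomputable def remainderIntegrand (x y k : ℝ) : ℝ :=
  Real.cos (x * k) * (Real.exp (-(y * decayRate k)) / decaySinh k
    - Real.exp (-(y * k)) * approxPoly y k / k)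

lemma measurable_remainderIntegrand (x y : ℝ) : Measurable (remainderIntegrand x y) := by
  have h1 := measurable_decaySinh
  have h2 : Measurable decayRate :=
    (Real.continuous_arsinh.comp (by fun_prop : Continuous fun k : ℝ => Real.sin (k / 2))).measurable
      |>.const_mul 2
  have h3 : Measurable (approxPoly y) := by
    unfold approxPoly
    fun_prop
  unfold remainderIntegrand
  fun_prop

lemma exists_abs_integral_remainderIntegrand_le :
    ∃ C, 0 < C ∧ ∀ x y : ℝ, 1 ≤ y →
      IntervalIntegrable (remainderIntegrand x y) volume 0 Real.pi ∧
      |∫ k in (0 : ℝ)..Real.pi, remainderIntegrand x y k| ≤ C / y ^ 6 := by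
  obtain ⟨C, hC, hb⟩ := exists_integrand_bound
  refine ⟨C * (120 * 4 ^ 6 + 720 * 4 ^ 7 + 5040 * 4 ^ 8 + 40320 * 4 ^ 9), by positivity,
    fun x y hy => ?_⟩
  have hy0 : 0 < y := by linarith
  have hy4 : 0 < y / 4 := by linarith
  set g : ℝ → ℝ := fun k => C * (k ^ 5 * Real.exp (-(y / 4 * k))
    + y * (k ^ 6 * Real.exp (-(y / 4 * k))) + y ^ 2 * (k ^ 7 * Real.exp (-(y / 4 * k)))
    + y ^ 3 * (k ^ 8 * Real.exp (-(y / 4 * k)))) with hg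
  have hi := fun j => integrableOn_pow_mul_exp j hy4
  have hi2 : IntegrableOn (fun k => k ^ 5 * Real.exp (-(y / 4 * k))
      + y * (k ^ 6 * Real.exp (-(y / 4 * k)))) (Set.Ioi 0) :=
    (hi 5).add ((hi 6).const_mul y)
  have hi3 : IntegrableOn (fun k => k ^ 5 * Real.exp (-(y / 4 * k))
      + y * (k ^ 6 * Real.exp (-(y / 4 * k))) + y ^ 2 * (k ^ 7 * Real.exp (-(y / 4 * k))))
      (Set.Ioi 0) :=
    hi2.add ((hi 7).const_mul (y ^ 2))
  have hgi : IntegrableOn g (Set.Ioi 0) := (hi3.add ((hi 8).const_mul (y ^ 3))).const_mul C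
  have hle : ∀ k ∈ Set.Ioc 0 Real.pi, ‖remainderIntegrand x y k‖ ≤ g k := by
    intro k hk
    rw [Real.norm_eq_abs, remainderIntegrand, abs_mul]
    refine (mul_le_of_le_one_left (abs_nonneg _) (Real.abs_cos_le_one _)).trans
      ((hb k y hk.1 hk.2 hy0.le).trans (le_of_eq ?_))
    simp only [hg]
    ring
  have hgI : ∫ k in Set.Ioi 0, g k
      = C * (120 * 4 ^ 6 + 720 * 4 ^ 7 + 5040 * 4 ^ 8 + 40320 * 4 ^ 9) / y ^ 6 := by
    simp only [hg]
    rw [integral_const_mul, integral_add hi3 ((hi 8).const_mul (y ^ 3)),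
      integral_add hi2 ((hi 7).const_mul (y ^ 2)),
      integral_add (hi 5) ((hi 6).const_mul y)]
    simp only [integral_const_mul, integral_pow_mul_exp _ hy4, Nat.factorial]
    push_cast
    field_simp
  have hgpos : ∀ k ∈ Set.Ioi (0 : ℝ), 0 ≤ g k := by
    intro k hk
    have hk0 : (0 : ℝ) < k := hk
    positivity
  have hae : ∀ᵐ k ∂volume.restrict (Set.Ioc 0 Real.pi), ‖remainderIntegrand x y k‖ ≤ g k := by
    filter_upwards [ae_restrict_mem measurableSet_Ioc] with k hk using hle k hk
  have hgi' : IntegrableOn g (Set.Ioc 0 Real.pi) := hgi.mono_set Set.Ioc_subset_Ioi_self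
  refine ⟨?_, ?_⟩
  · rw [intervalIntegrable_iff_integrableOn_Ioc_of_le Real.pi_pos.le]
    exact hgi'.mono' (measurable_remainderIntegrand x y).aestronglyMeasurable hae
  · rw [intervalIntegral.integral_of_le Real.pi_pos.le, ← hgI]
    refine (norm_integral_le_of_norm_le hgi' hae).trans ?_
    refine setIntegral_mono_set hgi ?_ Set.Ioc_subset_Ioi_self.eventuallyLE
    filter_upwards [ae_restrict_mem measurableSet_Ioi] with k hk using hgpos k hk

lemma exists_abs_integral_sub_expansion_le :
    ∃ C, 0 < C ∧ ∀ x y : ℝ, 1 ≤ y →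
      |(∫ k in (0 : ℝ)..Real.pi,
          (Real.exp (-(y * decayRate k)) * Real.cos (x * k) - 1) / decaySinh k)
        - (-(Real.log (x ^ 2 + y ^ 2) / 2) - Real.eulerMascheroniConstant - Real.log 8 / 2
          + rationalPart x y)| ≤ C / y ^ 6 := by
  obtain ⟨C, hC, hrem⟩ := exists_abs_integral_remainderIntegrand_le
  refine ⟨C + 5 * 5040 + 2 * 5040 + 240, by positivity, fun x y hy => ?_⟩
  have hy0 : 0 < y := by linarith
  obtain ⟨i1, b1⟩ := hrem x y hy
  have i2 := intervalIntegrable_polyIntegrand x hy0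
  have b2 := abs_integral_polyIntegrand_sub_le x hy
  have i3 := intervalIntegrable_exp_neg_mul_sub_one_div hy0.le Real.pi_pos.le
  have b3 := abs_integral_exp_neg_mul_sub_one_div_le hy
  have i4 := intervalIntegrable_of_integrableOn_Ioi (integrableOn_exp_mul_cos_sub_one_div x hy0)
  have b4 := abs_integral_exp_mul_cos_sub_one_div_sub_le x hy0
  have i5 := intervalIntegrable_inv_sub_inv_decaySinh
  have e5 := integral_inv_sub_inv_decaySinh
  rw [intervalIntegral.integral_congr_ae (g := fun k => remainderIntegrand x y k
      + polyIntegrand x y k + (Real.exp (-(y * k)) - 1) / k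
      + Real.exp (-(y * k)) * (Real.cos (x * k) - 1) / k + (k⁻¹ - (decaySinh k)⁻¹))
    (Filter.Eventually.of_forall fun k _ => by
      simp only [remainderIntegrand, polyIntegrand]
      ring),
    intervalIntegral.integral_add (((i1.add i2).add i3).add i4) i5,
    intervalIntegral.integral_add ((i1.add i2).add i3) i4,
    intervalIntegral.integral_add (i1.add i2) i3, intervalIntegral.integral_add i1 i2, e5]
  rw [abs_le] at b1 b2 b3 b4 ⊢
  simp only [add_div]
  constructor <;> linarith [b1.1, b1.2, b2.1, b2.2, b3.1, b3.2, b4.1, b4.2]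

lemma rationalPart_swap (x y : ℝ) : rationalPart y x = rationalPart x y := by
  rw [rationalPart, rationalPart, add_comm (y ^ 2)]
  congr 2 <;> ring

lemma exists_abs_phi_sub_expansion_le :
    ∃ C, 0 < C ∧ ∀ m : ℤ × ℤ, m ≠ (0, 0) →
      |phi m - 1 / (2 * Real.pi) *
        (-(Real.log ((m.1 : ℝ) ^ 2 + (m.2 : ℝ) ^ 2) / 2) - Real.eulerMascheroniConstant
          - Real.log 8 / 2 + rationalPart m.1 m.2)|
        ≤ C / ((m.1 : ℝ) ^ 2 + (m.2 : ℝ) ^ 2) ^ 3 := by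
  obtain ⟨C, hC, h⟩ := exists_abs_integral_sub_expansion_le
  refine ⟨8 * C, by positivity, fun m hm => ?_⟩
  wlog hle : |m.1| ≤ |m.2| generalizing m with H
  · have hs := H m.swap (fun h0 => hm (by rw [← Prod.swap_swap m, h0]; rfl)) (le_of_not_ge hle)
    rw [phi_swap, Prod.fst_swap, Prod.snd_swap, rationalPart_swap] at hs
    rwa [add_comm ((m.1 : ℝ) ^ 2)]
  have hle' : |(m.1 : ℝ)| ≤ |(m.2 : ℝ)| := by exact_mod_cast hle
  have hm2 : m.2 ≠ 0 := by
    intro h2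
    refine hm (Prod.ext ?_ h2)
    rw [h2, abs_zero] at hle
    exact abs_nonpos_iff.1 hle
  have hy : (1 : ℝ) ≤ |(m.2 : ℝ)| := by exact_mod_cast Int.one_le_abs hm2
  have hy0 : 0 < |(m.2 : ℝ)| := by linarith
  have hmain := h m.1 |(m.2 : ℝ)| hy
  have hrat : rationalPart m.1 |(m.2 : ℝ)| = rationalPart m.1 m.2 := by
    rcases abs_choice (m.2 : ℝ) with h' | h' <;> rw [h']
    simp only [rationalPart]
    ring
  rw [hrat, sq_abs] at hmain
  rw [phi_eq_integral, ← mul_sub, abs_mul]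
  have hpi : |1 / (2 * Real.pi)| ≤ 1 := by
    have := Real.pi_gt_three
    rw [abs_of_pos (by positivity), div_le_one (by positivity)]
    linarith
  refine (mul_le_of_le_one_left (abs_nonneg _) hpi).trans (hmain.trans ?_)
  have hsq : (m.1 : ℝ) ^ 2 + (m.2 : ℝ) ^ 2 ≤ 2 * |(m.2 : ℝ)| ^ 2 := by
    have := sq_le_sq.2 hle'
    rw [sq_abs]
    linarith
  have hpos : 0 < (m.1 : ℝ) ^ 2 + (m.2 : ℝ) ^ 2 := by
    have := sq_pos_of_pos hy0
    rw [sq_abs] at this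
    positivity
  rw [div_le_div_iff₀ (by positivity) (by positivity)]
  have h3 := pow_le_pow_left₀ hpos.le hsq 3
  calc C * ((m.1 : ℝ) ^ 2 + (m.2 : ℝ) ^ 2) ^ 3 ≤ C * (2 * |(m.2 : ℝ)| ^ 2) ^ 3 := by gcongr
    _ = 8 * C * |(m.2 : ℝ)| ^ 6 := by ring

/-- The asymptotic expansion of the lattice fundamental solution through order
`1/|m|⁴`, with error `O(1/|m|⁶)`. -/
theorem phi_asymptotic_expansion :
    ∃ C : ℝ, 0 < C ∧ ∀ m : ℤ × ℤ, m ≠ (0, 0) →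
      |phi m -
          (-(1 / (2 * Real.pi)) *
              (Real.log (latNorm m) + Real.eulerMascheroniConstant + Real.log 8 / 2)
            + (1 / (24 * Real.pi)) *
                (((m.1 : ℝ) ^ 4 - 6 * (m.1 : ℝ) ^ 2 * (m.2 : ℝ) ^ 2 + (m.2 : ℝ) ^ 4) /
                  latNorm m ^ 6)
            + (1 / (480 * Real.pi)) *
                ((43 * (m.1 : ℝ) ^ 8 - 772 * (m.1 : ℝ) ^ 6 * (m.2 : ℝ) ^ 2
                    + 1570 * (m.1 : ℝ) ^ 4 * (m.2 : ℝ) ^ 4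
                    - 772 * (m.1 : ℝ) ^ 2 * (m.2 : ℝ) ^ 6 + 43 * (m.2 : ℝ) ^ 8) /
                  latNorm m ^ 12))|
        ≤ C / latNorm m ^ 6 := by
  obtain ⟨C, hC, h⟩ := exists_abs_phi_sub_expansion_le
  refine ⟨C, hC, fun m hm => ?_⟩
  have hR : 0 ≤ (m.1 : ℝ) ^ 2 + (m.2 : ℝ) ^ 2 := by positivity
  have hsq : latNorm m ^ 2 = (m.1 : ℝ) ^ 2 + (m.2 : ℝ) ^ 2 := Real.sq_sqrt hR
  have h6 : latNorm m ^ 6 = ((m.1 : ℝ) ^ 2 + (m.2 : ℝ) ^ 2) ^ 3 := by rw [← hsq]; ring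
  have h12 : latNorm m ^ 12 = ((m.1 : ℝ) ^ 2 + (m.2 : ℝ) ^ 2) ^ 6 := by rw [← hsq]; ring
  have hlog : Real.log (latNorm m) = Real.log ((m.1 : ℝ) ^ 2 + (m.2 : ℝ) ^ 2) / 2 :=
    Real.log_sqrt hR
  rw [h6, h12, hlog]
  convert h m hm using 2
  rw [rationalPart]
  generalize (m.1 : ℝ) ^ 2 + (m.2 : ℝ) ^ 2 = R
  ring
end

section
/- Let w : ℤ² → ℝ satisfy w(m) → 0 as |m| = √(m₁² + m₂²) → ∞, and suppose f := Aw is finitely supported. Then Σ_{m ∈ ℤ²} f(m) = 0, and w is recovered by convolution with the lattice fundamental solution: w(m) = Σ_{n ∈ ℤ²} φ(m − n) f(n) for all m ∈ ℤ² (i.e. S(Aw) = w, where S denotes convolution with φ). -/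
open Real MeasureTheory Filter

/-- The discrete Laplace operator on `ℤ²`. -/
noncomputable def discLap (u : ℤ × ℤ → ℝ) (m : ℤ × ℤ) : ℝ :=
  4 * u m - u (m + (1, 0)) - u (m - (1, 0)) - u (m + (0, 1)) - u (m - (0, 1))

/-- Convolution with the lattice fundamental solution: `[Sf](m) = Σₙ φ(m−n) f(n)`. -/
noncomputable def latConv (f : ℤ × ℤ → ℝ) (m : ℤ × ℤ) : ℝ :=
  ∑ᶠ n : ℤ × ℤ, phi (m - n) * f n

/-- The symbol `4 sin²(t₁/2) + 4 sin²(t₂/2)` of the discrete Laplace operator. -/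
noncomputable def latSymbol (t : ℝ × ℝ) : ℝ :=
  4 * Real.sin (t.1 / 2) ^ 2 + 4 * Real.sin (t.2 / 2) ^ 2

/-- The Brillouin zone `[-π, π]²`. -/
def latSquare : Set (ℝ × ℝ) := Set.Icc (-Real.pi) Real.pi ×ˢ Set.Icc (-Real.pi) Real.pi

/-- The `N`-step transition kernel of the lazy simple random walk on `ℤ²`, as a Fourier
integral. -/
noncomputable def lazyKernel (N : ℕ) (m : ℤ × ℤ) : ℝ :=
  (1 / (2 * Real.pi) ^ 2) *
    ∫ t in latSquare, (1 - latSymbol t / 8) ^ N * Real.cos (t.1 * (m.1 : ℝ) + t.2 * (m.2 : ℝ))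

lemma latSymbol_nonneg (t : ℝ × ℝ) : 0 ≤ latSymbol t := by
  unfold latSymbol; positivity

lemma latSymbol_le (t : ℝ × ℝ) : latSymbol t ≤ 8 := by
  unfold latSymbol
  nlinarith [Real.sin_sq_le_one (t.1 / 2), Real.sin_sq_le_one (t.2 / 2)]

lemma latSymbol_eq (t : ℝ × ℝ) : latSymbol t = 4 - 2 * Real.cos t.1 - 2 * Real.cos t.2 := by
  have h : ∀ x : ℝ, Real.sin (x / 2) ^ 2 = (1 - Real.cos x) / 2 := fun x => by
    have := Real.cos_sq (x / 2)
    have h2 := Real.sin_sq_add_cos_sq (x / 2)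
    rw [show 2 * (x / 2) = x by ring] at this
    linarith
  rw [latSymbol, h, h]; ring

lemma continuous_latSymbol : Continuous latSymbol := by
  unfold latSymbol; fun_prop

lemma latSymbol_le_normSq (t : ℝ × ℝ) : latSymbol t ≤ t.1 ^ 2 + t.2 ^ 2 := by
  have h1 : Real.sin (t.1 / 2) ^ 2 ≤ (t.1 / 2) ^ 2 := sq_le_sq.2 Real.abs_sin_le_abs
  have h2 : Real.sin (t.2 / 2) ^ 2 ≤ (t.2 / 2) ^ 2 := sq_le_sq.2 Real.abs_sin_le_abs
  unfold latSymbol; nlinarith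

lemma four_mul_sq_le_sin_half_sq {x : ℝ} (hx : x ∈ Set.Icc (-Real.pi) Real.pi) :
    4 / Real.pi ^ 2 * x ^ 2 ≤ 4 * Real.sin (x / 2) ^ 2 := by
  have hpi := Real.pi_pos
  have hx' : |x| ≤ Real.pi := abs_le.2 hx
  have h := Real.mul_abs_le_abs_sin (x := x / 2) (by rw [abs_div, abs_two]; linarith)
  have h2 : (2 / Real.pi * |x / 2|) ^ 2 ≤ |Real.sin (x / 2)| ^ 2 := by gcongr
  rw [sq_abs, mul_pow, sq_abs] at h2
  calc 4 / Real.pi ^ 2 * x ^ 2 = 4 * ((2 / Real.pi) ^ 2 * (x / 2) ^ 2) := by ring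
    _ ≤ _ := by linarith

lemma normSq_le_latSymbol {t : ℝ × ℝ} (ht : t ∈ latSquare) :
    4 / Real.pi ^ 2 * (t.1 ^ 2 + t.2 ^ 2) ≤ latSymbol t := by
  have h1 := four_mul_sq_le_sin_half_sq ht.1
  have h2 := four_mul_sq_le_sin_half_sq ht.2
  unfold latSymbol; linarith

lemma latSymbol_pos {t : ℝ × ℝ} (ht : t ∈ latSquare) (h0 : t ≠ 0) : 0 < latSymbol t := by
  refine lt_of_lt_of_le ?_ (normSq_le_latSymbol ht)
  have hpi := Real.pi_pos
  have : 0 < t.1 ^ 2 + t.2 ^ 2 := by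
    by_contra! h
    exact h0 (Prod.ext (by simp; nlinarith [sq_nonneg t.1, sq_nonneg t.2])
      (by simp; nlinarith [sq_nonneg t.1, sq_nonneg t.2]))
  positivity

lemma abs_latticeKernel_le (m : ℤ × ℤ) {t : ℝ × ℝ} (ht : t ∈ latSquare) :
    |latticeKernel m t| ≤ ((m.1 : ℝ) ^ 2 + (m.2 : ℝ) ^ 2) * Real.pi ^ 2 / 8 := by
  have hpi := Real.pi_pos
  rw [latticeKernel, abs_div, ← latSymbol, abs_of_nonneg (latSymbol_nonneg t)]
  refine div_le_of_le_mul₀ (latSymbol_nonneg t) (by positivity) ?_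
  set x := t.1 * (m.1 : ℝ) + t.2 * (m.2 : ℝ) with hx
  have h1 : |Real.cos x - 1| ≤ x ^ 2 / 2 := by
    rw [abs_le]
    constructor <;> nlinarith [Real.one_sub_sq_div_two_le_cos (x := x), Real.cos_le_one x]
  have h2 : x ^ 2 ≤ ((m.1 : ℝ) ^ 2 + (m.2 : ℝ) ^ 2) * (t.1 ^ 2 + t.2 ^ 2) := by
    rw [hx]; nlinarith [sq_nonneg (t.1 * (m.2 : ℝ) - t.2 * (m.1 : ℝ))]
  calc |Real.cos x - 1| ≤ ((m.1 : ℝ) ^ 2 + (m.2 : ℝ) ^ 2) * (t.1 ^ 2 + t.2 ^ 2) / 2 := by linarith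
    _ = ((m.1 : ℝ) ^ 2 + (m.2 : ℝ) ^ 2) * Real.pi ^ 2 / 8 *
          (4 / Real.pi ^ 2 * (t.1 ^ 2 + t.2 ^ 2)) := by field_simp; ring
    _ ≤ _ := by gcongr; exact normSq_le_latSymbol ht

lemma isCompact_latSquare : IsCompact latSquare := isCompact_Icc.prod isCompact_Icc

lemma measurableSet_latSquare : MeasurableSet latSquare :=
  measurableSet_Icc.prod measurableSet_Icc

lemma Continuous.integrableOn_latSquare {g : ℝ × ℝ → ℝ} (hg : Continuous g) :
    IntegrableOn g latSquare :=
  hg.continuousOn.integrableOn_compact isCompact_latSquare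

lemma integrableOn_const_latSquare (c : ℝ) : IntegrableOn (fun _ : ℝ × ℝ => c) latSquare :=
  continuous_const.integrableOn_latSquare

lemma ae_latSquare_ne_zero : ∀ᵐ t ∂(volume.restrict latSquare), t ∈ latSquare ∧ t ≠ 0 := by
  refine (ae_restrict_mem measurableSet_latSquare).and (ae_restrict_of_ae ?_)
  exact Measure.ae_ne volume (0 : ℝ × ℝ)

lemma continuous_lazyIntegrand (N : ℕ) (m : ℤ × ℤ) : Continuous fun t : ℝ × ℝ =>
    (1 - latSymbol t / 8) ^ N * Real.cos (t.1 * (m.1 : ℝ) + t.2 * (m.2 : ℝ)) := by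
  have := continuous_latSymbol
  fun_prop

lemma integral_cos_int_mul (n : ℤ) :
    ∫ x in Set.Icc (-Real.pi) Real.pi, Real.cos (x * (n : ℝ)) =
      if n = 0 then 2 * Real.pi else 0 := by
  rw [integral_Icc_eq_integral_Ioc,
    ← intervalIntegral.integral_of_le (by linarith [Real.pi_pos])]
  split_ifs with h
  · simp [h]; ring
  · have hn : (n : ℝ) ≠ 0 := by exact_mod_cast h
    rw [intervalIntegral.integral_comp_mul_right (fun x => Real.cos x) hn]
    simp [mul_comm Real.pi, Real.sin_int_mul_pi]

lemma integral_sin_int_mul (n : ℤ) :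
    ∫ x in Set.Icc (-Real.pi) Real.pi, Real.sin (x * (n : ℝ)) = 0 := by
  rw [integral_Icc_eq_integral_Ioc,
    ← intervalIntegral.integral_of_le (by linarith [Real.pi_pos])]
  by_cases h : n = 0
  · simp [h]
  · have hn : (n : ℝ) ≠ 0 := by exact_mod_cast h
    rw [intervalIntegral.integral_comp_mul_right (fun x => Real.sin x) hn]
    simp

lemma lazyKernel_zero (m : ℤ × ℤ) : lazyKernel 0 m = if m = 0 then 1 else 0 := by
  have hpi := Real.pi_pos
  simp only [lazyKernel, pow_zero, one_mul, Real.cos_add]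
  rw [integral_sub (Continuous.integrableOn_latSquare (by fun_prop))
    (Continuous.integrableOn_latSquare (by fun_prop)), latSquare, Measure.volume_eq_prod,
    setIntegral_prod_mul (fun x => Real.cos (x * (m.1 : ℝ))) (fun x => Real.cos (x * (m.2 : ℝ))),
    setIntegral_prod_mul (fun x => Real.sin (x * (m.1 : ℝ))) (fun x => Real.sin (x * (m.2 : ℝ))),
    integral_cos_int_mul, integral_cos_int_mul, integral_sin_int_mul]
  obtain ⟨a, b⟩ := m
  by_cases ha : a = 0 <;> by_cases hb : b = 0 <;> simp [ha, hb]
  field_simp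

lemma lazyKernel_succ (N : ℕ) (m : ℤ × ℤ) :
    lazyKernel (N + 1) m = lazyKernel N m - discLap (lazyKernel N) m / 8 := by
  have hi := fun k : ℤ × ℤ => (continuous_lazyIntegrand N k).integrableOn_latSquare
  have key : ∫ t in latSquare, (1 - latSymbol t / 8) ^ (N + 1) *
      Real.cos (t.1 * (m.1 : ℝ) + t.2 * (m.2 : ℝ)) =
      ∫ t in latSquare, (1 / 2 * ((1 - latSymbol t / 8) ^ N *
          Real.cos (t.1 * (m.1 : ℝ) + t.2 * (m.2 : ℝ))) +
        1 / 8 * ((((1 - latSymbol t / 8) ^ N *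
          Real.cos (t.1 * ((m + (1, 0)).1 : ℝ) + t.2 * ((m + (1, 0)).2 : ℝ)) +
        (1 - latSymbol t / 8) ^ N *
          Real.cos (t.1 * ((m - (1, 0)).1 : ℝ) + t.2 * ((m - (1, 0)).2 : ℝ))) +
        (1 - latSymbol t / 8) ^ N *
          Real.cos (t.1 * ((m + (0, 1)).1 : ℝ) + t.2 * ((m + (0, 1)).2 : ℝ))) +
        (1 - latSymbol t / 8) ^ N *
          Real.cos (t.1 * ((m - (0, 1)).1 : ℝ) + t.2 * ((m - (0, 1)).2 : ℝ)))) := by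
    congr 1; ext t
    obtain ⟨x, hx⟩ : ∃ x, t.1 * (m.1 : ℝ) + t.2 * (m.2 : ℝ) = x := ⟨_, rfl⟩
    have e1 : t.1 * ((m + (1, 0)).1 : ℝ) + t.2 * ((m + (1, 0)).2 : ℝ) = x + t.1 := by
      rw [← hx]; push_cast [Prod.fst_add, Prod.snd_add, Prod.fst_sub, Prod.snd_sub]; ring
    have e2 : t.1 * ((m - (1, 0)).1 : ℝ) + t.2 * ((m - (1, 0)).2 : ℝ) = x - t.1 := by
      rw [← hx]; push_cast [Prod.fst_add, Prod.snd_add, Prod.fst_sub, Prod.snd_sub]; ring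
    have e3 : t.1 * ((m + (0, 1)).1 : ℝ) + t.2 * ((m + (0, 1)).2 : ℝ) = x + t.2 := by
      rw [← hx]; push_cast [Prod.fst_add, Prod.snd_add, Prod.fst_sub, Prod.snd_sub]; ring
    have e4 : t.1 * ((m - (0, 1)).1 : ℝ) + t.2 * ((m - (0, 1)).2 : ℝ) = x - t.2 := by
      rw [← hx]; push_cast [Prod.fst_add, Prod.snd_add, Prod.fst_sub, Prod.snd_sub]; ring
    rw [hx, e1, e2, e3, e4, Real.cos_add, Real.cos_add, Real.cos_sub, Real.cos_sub, pow_succ]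
    nth_rewrite 2 [latSymbol_eq]
    ring
  have expand : ∀ g a b c d : ℝ × ℝ → ℝ, IntegrableOn g latSquare → IntegrableOn a latSquare →
      IntegrableOn b latSquare → IntegrableOn c latSquare → IntegrableOn d latSquare →
      ∫ t in latSquare, (1 / 2 * g t + 1 / 8 * (((a t + b t) + c t) + d t)) =
        1 / 2 * (∫ t in latSquare, g t) + 1 / 8 * ((((∫ t in latSquare, a t) +
          ∫ t in latSquare, b t) + ∫ t in latSquare, c t) + ∫ t in latSquare, d t) := by
    intro g a b c d hg ha hb hc hd
    have hab : IntegrableOn (fun t => a t + b t) latSquare := ha.add hb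
    have habc : IntegrableOn (fun t => a t + b t + c t) latSquare := hab.add hc
    have habcd : IntegrableOn (fun t => a t + b t + c t + d t) latSquare := habc.add hd
    rw [integral_add (hg.const_mul _) (habcd.const_mul _), integral_const_mul,
      integral_const_mul, integral_add habc hd, integral_add hab hc, integral_add ha hb]
  rw [lazyKernel, key, expand _ _ _ _ _ (hi _) (hi _) (hi _) (hi _) (hi _)]
  simp only [discLap, lazyKernel]
  ring

lemma lazyKernel_nonneg (N : ℕ) (m : ℤ × ℤ) : 0 ≤ lazyKernel N m := by
  induction N generalizing m with
  | zero => rw [lazyKernel_zero]; split_ifs <;> norm_num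
  | succ N ih =>
    rw [lazyKernel_succ, discLap]
    linarith [ih m, ih (m + (1, 0)), ih (m - (1, 0)), ih (m + (0, 1)), ih (m - (0, 1))]

lemma finite_support_comp_add {u : ℤ × ℤ → ℝ} (hu : u.support.Finite) (e : ℤ × ℤ) :
    (Function.support fun n => u (n + e)).Finite :=
  hu.preimage (add_left_injective e).injOn

lemma finite_support_discLap {u : ℤ × ℤ → ℝ} (hu : u.support.Finite) :
    (discLap u).support.Finite := by
  refine ((((hu.union (finite_support_comp_add hu (1, 0))).union
    (finite_support_comp_add hu (-(1, 0)))).union (finite_support_comp_add hu (0, 1))).union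
    (finite_support_comp_add hu (-(0, 1)))).subset fun n hn => ?_
  contrapose! hn
  simp only [Set.mem_union, Function.mem_support, not_or, not_not, ← sub_eq_add_neg] at hn
  simp [discLap, hn]

lemma finite_support_lazyKernel (N : ℕ) : (lazyKernel N).support.Finite := by
  induction N with
  | zero =>
    refine (Set.finite_singleton (0 : ℤ × ℤ)).subset fun n hn => ?_
    simpa [lazyKernel_zero] using hn
  | succ N ih =>
    refine (ih.union (finite_support_discLap ih)).subset fun n hn => ?_
    contrapose! hn
    simp only [Set.mem_union, Function.mem_support, not_or, not_not] at hn
    simp [lazyKernel_succ, hn]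

lemma finsum_shift_mul (p u : ℤ × ℤ → ℝ) (m e : ℤ × ℤ) :
    ∑ᶠ n, p (n + e) * u (m - n) = ∑ᶠ n, p n * u (m - n + e) := by
  rw [← finsum_comp_equiv (Equiv.addRight e) (f := fun n => p n * u (m - n + e))]
  congr 1; ext n
  simp [sub_add_eq_sub_sub]

lemma finsum_discLap_mul {p : ℤ × ℤ → ℝ} (hp : p.support.Finite) (u : ℤ × ℤ → ℝ) (m : ℤ × ℤ) :
    ∑ᶠ n, discLap p n * u (m - n) = ∑ᶠ n, p n * discLap u (m - n) := by
  have hL : ∀ e, (Function.support fun n => p (n + e) * u (m - n)).Finite := fun e =>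
    (finite_support_comp_add hp e).subset (Function.support_mul_subset_left _ _)
  have hR : ∀ v : ℤ × ℤ → ℝ, (Function.support fun n => p n * v n).Finite := fun v =>
    hp.subset (Function.support_mul_subset_left _ _)
  have expand : ∀ a b c d e : ℤ × ℤ → ℝ, a.support.Finite → b.support.Finite →
      c.support.Finite → d.support.Finite → e.support.Finite →
      ∑ᶠ n, (4 * a n - b n - c n - d n - e n) =
        4 * ∑ᶠ n, a n - ∑ᶠ n, b n - ∑ᶠ n, c n - ∑ᶠ n, d n - ∑ᶠ n, e n := by
    intro a b c d e ha hb hc hd he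
    set s := ha.toFinset ∪ hb.toFinset ∪ hc.toFinset ∪ hd.toFinset ∪ he.toFinset with hs
    have hsub : ∀ g : ℤ × ℤ → ℝ, g.support ⊆ s → ∑ᶠ n, g n = ∑ n ∈ s, g n := fun g hg =>
      finsum_eq_sum_of_support_subset g hg
    rw [hsub a (by intro; simp +contextual [hs]), hsub b (by intro; simp +contextual [hs]),
      hsub c (by intro; simp +contextual [hs]), hsub d (by intro; simp +contextual [hs]),
      hsub e (by intro; simp +contextual [hs]), hsub]
    · simp only [Finset.sum_sub_distrib, Finset.mul_sum]
    · intro n hn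
      contrapose! hn
      simp only [hs, Finset.coe_union, Set.Finite.coe_toFinset, Set.mem_union,
        Function.mem_support, not_or, not_not] at hn
      simp [hn]
  have e1 : ∀ n, discLap p n * u (m - n) = 4 * (p n * u (m - n)) -
      p (n + (1, 0)) * u (m - n) - p (n + -(1, 0)) * u (m - n) -
      p (n + (0, 1)) * u (m - n) - p (n + -(0, 1)) * u (m - n) := fun n => by
    simp only [discLap, ← sub_eq_add_neg]; ring
  have e2 : ∀ n, p n * discLap u (m - n) = 4 * (p n * u (m - n)) -
      p n * u (m - n + (1, 0)) - p n * u (m - n + -(1, 0)) -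
      p n * u (m - n + (0, 1)) - p n * u (m - n + -(0, 1)) := fun n => by
    simp only [discLap, ← sub_eq_add_neg]; ring
  rw [finsum_congr e1, finsum_congr e2,
    expand _ _ _ _ _ (hR _) (hL _) (hL _) (hL _) (hL _),
    expand _ _ _ _ _ (hR _) (hR _) (hR _) (hR _) (hR _)]
  simp only [finsum_shift_mul]

lemma finsum_lazyKernel_succ_mul (N : ℕ) (u : ℤ × ℤ → ℝ) (m : ℤ × ℤ) :
    ∑ᶠ n, lazyKernel (N + 1) n * u (m - n) =
      ∑ᶠ n, lazyKernel N n * u (m - n) - (∑ᶠ n, lazyKernel N n * discLap u (m - n)) / 8 := by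
  have hp := finite_support_lazyKernel N
  rw [← finsum_discLap_mul hp, div_eq_inv_mul, mul_finsum, ← finsum_sub_distrib]
  · refine finsum_congr fun n => ?_
    rw [lazyKernel_succ]; ring
  · exact hp.subset (Function.support_mul_subset_left _ _)
  · refine (finite_support_discLap hp).subset fun n hn => ?_
    contrapose! hn
    simp only [Function.mem_support, not_not] at hn
    simp [hn]

lemma finsum_lazyKernel (N : ℕ) : ∑ᶠ n, lazyKernel N n = 1 := by
  induction N with
  | zero =>
    rw [finsum_eq_single _ (0 : ℤ × ℤ) fun n hn => by simp [lazyKernel_zero, hn]]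
    simp [lazyKernel_zero]
  | succ N ih =>
    have := finsum_lazyKernel_succ_mul N (fun _ => 1) 0
    have h0 : ∀ k, discLap (fun _ => 1) k = 0 := fun k => by norm_num [discLap]
    simpa [h0, ih] using this

lemma eq_finsum_lazyKernel_add (w : ℤ × ℤ → ℝ) (m : ℤ × ℤ) (N : ℕ) :
    w m = ∑ᶠ n, lazyKernel N n * w (m - n) +
      ∑ k ∈ Finset.range N, (∑ᶠ n, lazyKernel k (m - n) * discLap w n) / 8 := by
  induction N with
  | zero =>
    rw [finsum_eq_single _ (0 : ℤ × ℤ) fun n hn => by simp [lazyKernel_zero, hn]]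
    simp [lazyKernel_zero]
  | succ N ih =>
    rw [Finset.sum_range_succ, finsum_lazyKernel_succ_mul]
    rw [← finsum_comp_equiv (Equiv.subLeft m)
      (f := fun n => lazyKernel N (m - n) * discLap w n)]
    simp only [Equiv.subLeft_apply, sub_sub_cancel]
    linarith

lemma tendsto_lazyKernel (m : ℤ × ℤ) : Tendsto (fun N => lazyKernel N m) atTop (nhds 0) := by
  have : Tendsto (fun N : ℕ => ∫ t in latSquare, (1 - latSymbol t / 8) ^ N *
      Real.cos (t.1 * (m.1 : ℝ) + t.2 * (m.2 : ℝ))) atTop (nhds (∫ t in latSquare, (0 : ℝ))) := by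
    refine tendsto_integral_of_dominated_convergence (fun _ => 1)
      (fun N => (continuous_lazyIntegrand N m).aestronglyMeasurable)
      (integrableOn_const_latSquare 1) (fun N => ae_of_all _ fun t => ?_) ?_
    · rw [norm_mul, norm_pow]
      refine mul_le_one₀ (pow_le_one₀ (norm_nonneg _) ?_) (norm_nonneg _) (Real.abs_cos_le_one _)
      rw [Real.norm_eq_abs, abs_le]
      constructor <;> linarith [latSymbol_nonneg t, latSymbol_le t]
    · filter_upwards [ae_latSquare_ne_zero] with t ht
      have := tendsto_pow_atTop_nhds_zero_of_lt_one (r := 1 - latSymbol t / 8)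
        (by linarith [latSymbol_le t]) (by linarith [latSymbol_pos ht.1 ht.2])
      simpa using this.mul_const (Real.cos (t.1 * (m.1 : ℝ) + t.2 * (m.2 : ℝ)))
  simpa only [lazyKernel, integral_zero, mul_zero] using
    this.const_mul (1 / (2 * Real.pi) ^ 2)

lemma tendsto_sum_lazyKernel_sub (m : ℤ × ℤ) :
    Tendsto (fun N => ∑ k ∈ Finset.range N, (lazyKernel k m - lazyKernel k 0) / 8) atTop
      (nhds (phi m)) := by
  have heq : ∀ N, ∑ k ∈ Finset.range N, (lazyKernel k m - lazyKernel k 0) / 8 =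
      (1 / (2 * Real.pi) ^ 2) *
        ∫ t in latSquare, (1 - (1 - latSymbol t / 8) ^ N) * latticeKernel m t := by
    intro N
    have h1 : ∀ k, (lazyKernel k m - lazyKernel k 0) / 8 = (1 / (2 * Real.pi) ^ 2) *
        ∫ t in latSquare, ((1 - latSymbol t / 8) ^ k *
          Real.cos (t.1 * (m.1 : ℝ) + t.2 * (m.2 : ℝ)) - (1 - latSymbol t / 8) ^ k *
          Real.cos (t.1 * ((0 : ℤ × ℤ).1 : ℝ) + t.2 * ((0 : ℤ × ℤ).2 : ℝ))) / 8 := fun k => by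
      rw [integral_div, integral_sub (continuous_lazyIntegrand k m).integrableOn_latSquare
        (continuous_lazyIntegrand k 0).integrableOn_latSquare]
      simp only [lazyKernel]; ring
    simp only [h1]
    rw [← Finset.mul_sum, ← integral_finsetSum]
    · congr 1
      refine integral_congr_ae ?_
      filter_upwards [ae_latSquare_ne_zero] with t ht
      have hpos := latSymbol_pos ht.1 ht.2
      have hg := geom_sum_mul_neg (1 - latSymbol t / 8) N
      rw [← hg, latticeKernel, ← latSymbol, Finset.sum_mul, Finset.sum_mul]
      refine Finset.sum_congr rfl fun k _ => ?_
      simp only [Prod.fst_zero, Prod.snd_zero, Int.cast_zero, mul_zero, add_zero, Real.cos_zero,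
        mul_one]
      field_simp
      ring
    · intro k _
      exact Continuous.integrableOn_latSquare
        (((continuous_lazyIntegrand k m).sub (continuous_lazyIntegrand k 0)).div_const 8)
  simp only [heq]
  refine Tendsto.const_mul _ ?_
  refine tendsto_integral_of_dominated_convergence
    (fun _ => ((m.1 : ℝ) ^ 2 + (m.2 : ℝ) ^ 2) * Real.pi ^ 2 / 8)
    (fun N => ?_) (integrableOn_const_latSquare _) (fun N => ?_) ?_
  · have := continuous_latSymbol
    refine Measurable.aestronglyMeasurable (Measurable.mul (by fun_prop) ?_)
    unfold latticeKernel
    fun_prop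
  · filter_upwards [ae_latSquare_ne_zero] with t ht
    have h0 : 0 ≤ 1 - latSymbol t / 8 := by linarith [latSymbol_le t]
    have h1 : 1 - latSymbol t / 8 ≤ 1 := by linarith [latSymbol_nonneg t]
    have h2 := pow_le_one₀ (n := N) h0 h1
    have h3 := pow_nonneg h0 N
    rw [norm_mul, Real.norm_of_nonneg (by linarith)]
    refine le_trans (mul_le_of_le_one_left (norm_nonneg _) (by linarith)) ?_
    exact abs_latticeKernel_le m ht.1
  · filter_upwards [ae_latSquare_ne_zero] with t ht
    have := tendsto_pow_atTop_nhds_zero_of_lt_one (r := 1 - latSymbol t / 8)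
      (by linarith [latSymbol_le t]) (by linarith [latSymbol_pos ht.1 ht.2])
    simpa using (this.const_sub 1).mul_const (latticeKernel m t)

lemma lazyKernel_self_lower_bound (N : ℕ) :
    3 / (4 * Real.pi ^ 2) * (1 / ((N : ℝ) + 1)) ≤ lazyKernel N 0 := by
  have hpi := Real.pi_pos
  set r : ℝ := 1 / √((N : ℝ) + 1) with hr
  have hr0 : 0 < r := by positivity
  have hr2 : r ^ 2 = 1 / ((N : ℝ) + 1) := by
    rw [hr, div_pow, Real.sq_sqrt (by positivity), one_pow]
  have hr1 : r ≤ 1 := by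
    have : r ^ 2 ≤ 1 := by
      rw [hr2, div_le_one (by positivity)]; linarith [(Nat.cast_nonneg N : (0 : ℝ) ≤ N)]
    nlinarith
  set B : Set (ℝ × ℝ) := Set.Icc (-r) r ×ˢ Set.Icc (-r) r with hB
  have hBs : B ⊆ latSquare := by
    have := Real.pi_gt_three
    exact Set.prod_mono (Set.Icc_subset_Icc (by linarith) (by linarith))
      (Set.Icc_subset_Icc (by linarith) (by linarith))
  have hBm : MeasurableSet B := measurableSet_Icc.prod measurableSet_Icc
  have hcont : Continuous fun t : ℝ × ℝ => (1 - latSymbol t / 8) ^ N := by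
    have := continuous_latSymbol
    fun_prop
  have hvol : volume.real B = (2 * r) * (2 * r) := by
    rw [hB, Measure.volume_eq_prod, measureReal_prod_prod]
    simp [Real.volume_real_Icc]
    rw [max_eq_left (by linarith)]
    ring
  have h1 : ∫ _ in B, (3 / 4 : ℝ) ≤ ∫ t in B, (1 - latSymbol t / 8) ^ N := by
    refine setIntegral_mono_on ((integrableOn_const_latSquare _).mono_set hBs)
      (hcont.integrableOn_latSquare.mono_set hBs) hBm fun t ht => ?_
    have ht1 : t.1 ^ 2 ≤ r ^ 2 := sq_le_sq' ht.1.1 ht.1.2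
    have ht2 : t.2 ^ 2 ≤ r ^ 2 := sq_le_sq' ht.2.1 ht.2.2
    have hs : latSymbol t / 8 ≤ r ^ 2 / 4 := by linarith [latSymbol_le_normSq t]
    have hber := one_add_mul_le_pow (a := -(latSymbol t / 8)) (by linarith [latSymbol_le t]) N
    have hN : (N : ℝ) * (latSymbol t / 8) ≤ 1 / 4 := by
      calc (N : ℝ) * (latSymbol t / 8) ≤ ((N : ℝ) + 1) * (r ^ 2 / 4) := by
            gcongr
            · exact div_nonneg (latSymbol_nonneg t) (by norm_num)
            · linarith
        _ = 1 / 4 := by rw [hr2]; field_simp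
    rw [← sub_eq_add_neg] at hber
    linarith
  have h2 : ∫ t in B, (1 - latSymbol t / 8) ^ N ≤ ∫ t in latSquare, (1 - latSymbol t / 8) ^ N :=
    setIntegral_mono_set hcont.integrableOn_latSquare
      (ae_of_all _ fun t => pow_nonneg (by linarith [latSymbol_le t]) N) hBs.eventuallyLE
  rw [setIntegral_const, hvol, smul_eq_mul] at h1
  have h3 : lazyKernel N 0 =
      (1 / (2 * Real.pi) ^ 2) * ∫ t in latSquare, (1 - latSymbol t / 8) ^ N := by
    simp [lazyKernel]
  rw [h3, ← hr2]
  calc 3 / (4 * Real.pi ^ 2) * r ^ 2 = (1 / (2 * Real.pi) ^ 2) * (2 * r * (2 * r) * (3 / 4)) := by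
        field_simp
    _ ≤ _ := by gcongr; exact h1.trans h2

lemma tendsto_sum_lazyKernel_self :
    Tendsto (fun N => ∑ k ∈ Finset.range N, lazyKernel k 0 / 8) atTop atTop := by
  have h := Real.tendsto_sum_range_one_div_nat_succ_atTop.const_mul_atTop
    (show (0 : ℝ) < 3 / (4 * Real.pi ^ 2) / 8 by positivity)
  refine tendsto_atTop_mono (fun N => ?_) h
  rw [Finset.mul_sum]
  gcongr with k _
  linarith [lazyKernel_self_lower_bound k]

lemma finite_setOf_latNorm_lt (R : ℝ) : {n : ℤ × ℤ | latNorm n < R}.Finite := by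
  refine ((Set.finite_Icc (-⌈R⌉) ⌈R⌉).prod (Set.finite_Icc (-⌈R⌉) ⌈R⌉)).subset fun n hn => ?_
  have hn' : latNorm n < R := hn
  have h1 : |(n.1 : ℝ)| ≤ latNorm n := Real.abs_le_sqrt (by nlinarith [sq_nonneg (n.2 : ℝ)])
  have h2 : |(n.2 : ℝ)| ≤ latNorm n := Real.abs_le_sqrt (by nlinarith [sq_nonneg (n.1 : ℝ)])
  have h3 := Int.le_ceil R
  have h4 : |n.1| ≤ ⌈R⌉ := by exact_mod_cast (by linarith : |(n.1 : ℝ)| ≤ (⌈R⌉ : ℝ))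
  have h5 : |n.2| ≤ ⌈R⌉ := by exact_mod_cast (by linarith : |(n.2 : ℝ)| ≤ (⌈R⌉ : ℝ))
  exact ⟨abs_le.1 h4, abs_le.1 h5⟩

lemma tendsto_finsum_lazyKernel_mul {w : ℤ × ℤ → ℝ}
    (hdecay : Tendsto w (comap latNorm atTop) (nhds 0)) (m : ℤ × ℤ) :
    Tendsto (fun N => ∑ᶠ n, lazyKernel N n * w (m - n)) atTop (nhds 0) := by
  rw [Metric.tendsto_nhds]
  intro ε hε
  have hev := (Metric.tendsto_nhds.1 hdecay) (ε / 2) (by positivity)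
  rw [eventually_comap] at hev
  obtain ⟨R, hR⟩ := eventually_atTop.1 hev
  have hfin : {n : ℤ × ℤ | latNorm (m - n) < R}.Finite :=
    (finite_setOf_latNorm_lt R).preimage (sub_right_injective.injOn)
  have hlim : Tendsto (fun N => ∑ n ∈ hfin.toFinset, lazyKernel N n * |w (m - n)|) atTop
      (nhds 0) := by
    simpa using tendsto_finsetSum hfin.toFinset fun n _ =>
      (tendsto_lazyKernel n).mul_const |w (m - n)|
  filter_upwards [(tendsto_order.1 hlim).2 (ε / 2) (by positivity)] with N hN
  have hp := finite_support_lazyKernel N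
  rw [Real.dist_eq, sub_zero]
  set s := hp.toFinset ∪ hfin.toFinset with hs
  have hsupp : (lazyKernel N).support ⊆ s := fun n hn => by simp [hs]; exact Or.inl hn
  rw [finsum_eq_sum_of_support_subset _
    ((Function.support_mul_subset_left _ _).trans hsupp)]
  have hone := finsum_lazyKernel N
  rw [finsum_eq_sum_of_support_subset _ hsupp] at hone
  have hbound : ∀ n ∈ s, |lazyKernel N n * w (m - n)| ≤
      (if n ∈ hfin.toFinset then lazyKernel N n * |w (m - n)| else 0) +
        lazyKernel N n * (ε / 2) := by
    intro n _
    have h0 := lazyKernel_nonneg N n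
    rw [abs_mul, abs_of_nonneg h0]
    split_ifs with h
    · have : 0 ≤ lazyKernel N n * (ε / 2) := by positivity
      linarith
    · have hle : R ≤ latNorm (m - n) := by simpa using h
      have := hR _ hle (m - n) rfl
      rw [Real.dist_eq, sub_zero] at this
      rw [zero_add]
      gcongr
  calc |∑ n ∈ s, lazyKernel N n * w (m - n)|
      ≤ ∑ n ∈ s, |lazyKernel N n * w (m - n)| := Finset.abs_sum_le_sum_abs _ _
    _ ≤ _ := Finset.sum_le_sum hbound
    _ = ∑ n ∈ hfin.toFinset, lazyKernel N n * |w (m - n)| + ε / 2 := by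
        rw [Finset.sum_add_distrib, ← Finset.sum_mul, hone, one_mul, Finset.sum_ite_mem,
          Finset.inter_eq_right.2 Finset.subset_union_right]
    _ < ε := by linarith

lemma tendsto_sum_lazyKernel_self_mul_charge {w : ℤ × ℤ → ℝ}
    (hdecay : Tendsto w (comap latNorm atTop) (nhds 0))
    (hf : (Function.support (discLap w)).Finite) (m : ℤ × ℤ) :
    Tendsto (fun N => (∑ k ∈ Finset.range N, lazyKernel k 0 / 8) * ∑ᶠ n, discLap w n) atTop
      (nhds (w m - latConv (discLap w) m)) := by
  have hsum : ∀ g : ℤ × ℤ → ℝ,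
      ∑ᶠ n, g n * discLap w n = ∑ n ∈ hf.toFinset, g n * discLap w n := fun g =>
    finsum_eq_sum_of_support_subset _ (by
      rw [Set.Finite.coe_toFinset]; exact Function.support_mul_subset_right _ _)
  have hconv : Tendsto (fun N => ∑ n ∈ hf.toFinset,
      (∑ k ∈ Finset.range N, (lazyKernel k (m - n) - lazyKernel k 0) / 8) * discLap w n) atTop
      (nhds (latConv (discLap w) m)) := by
    rw [latConv, hsum]
    exact tendsto_finsetSum _ fun n _ => (tendsto_sum_lazyKernel_sub (m - n)).mul_const _
  have hlim := ((tendsto_finsum_lazyKernel_mul hdecay m).const_sub (w m)).sub hconv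
  rw [sub_zero] at hlim
  refine hlim.congr fun N => ?_
  have h1 := eq_finsum_lazyKernel_add w m N
  simp only [hsum] at h1
  have h2 : ∑ k ∈ Finset.range N, (∑ n ∈ hf.toFinset, lazyKernel k (m - n) * discLap w n) / 8 =
      ∑ n ∈ hf.toFinset, (∑ k ∈ Finset.range N, lazyKernel k (m - n) / 8) * discLap w n := by
    simp only [Finset.sum_div, Finset.sum_mul]
    rw [Finset.sum_comm]
    exact Finset.sum_congr rfl fun n _ => Finset.sum_congr rfl fun k _ => by ring
  have h3 : ∑ᶠ n, discLap w n = ∑ n ∈ hf.toFinset, discLap w n := finsum_eq_sum _ hf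
  simp only [sub_div, Finset.sum_sub_distrib, sub_mul]
  rw [h3, Finset.mul_sum, ← h2]
  linarith

/-- If `w` decays at infinity and `f := Aw` is finitely supported, then `f` has
total charge zero and `w` is recovered by convolution with the fundamental
solution: `S(Aw) = w`. -/
theorem latConv_discLap (w : ℤ × ℤ → ℝ)
    (hdecay : Filter.Tendsto w (Filter.comap latNorm Filter.atTop) (nhds 0))
    (hf : (Function.support (discLap w)).Finite) :
    (∑ᶠ m : ℤ × ℤ, discLap w m = 0) ∧
    ∀ m : ℤ × ℤ, w m = latConv (discLap w) m := by
  have hlim := tendsto_sum_lazyKernel_self_mul_charge hdecay hf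
  have hcharge : ∑ᶠ m : ℤ × ℤ, discLap w m = 0 := by
    by_contra h
    have hq := (hlim 0).mul_const (∑ᶠ m : ℤ × ℤ, discLap w m)⁻¹
    simp only [mul_assoc, mul_inv_cancel₀ h, mul_one] at hq
    exact not_tendsto_nhds_of_tendsto_atTop tendsto_sum_lazyKernel_self _ hq
  refine ⟨hcharge, fun m => ?_⟩
  have hm := hlim m
  simp only [hcharge, mul_zero] at hm
  linarith [tendsto_nhds_unique hm tendsto_const_nhds]
end
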